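/- arXiv:2312.10364 — 8 statements merged into one kernel-verified Lean document; each statement's English description precedes it below -/
import Mathlib

section
/- Let Ω ⊂ ℝⁿ be a convex open set and f ∈ USC(Ω) be locally bounded. Suppose that whenever f − φ attains a strict local maximum at a point x̂ ∈ Ω for a smooth function φ: Ω → ℝ, one has L₀*(∇φ(x̂), ∇²φ(x̂)) ≥ 0. If f does not attain a local maximum in Ω, then f is quasiconvex in Ω. -/
open Filter Topology Matrix

noncomputable section

/-- Hessian matrix of `φ : ℝⁿ → ℝ` at `x`, entries `∂_i ∂_j φ (x)`. -/
def hessE (n : ℕ) (φ : EuclideanSpace ℝ (Fin n) → ℝ) (x : EuclideanSpace ℝ (Fin n)) :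
    Matrix (Fin n) (Fin n) ℝ :=
  fun i j => fderiv ℝ (fun y => fderiv ℝ φ y (EuclideanSpace.single j 1)) x
    (EuclideanSpace.single i 1)

/-- Gradient of `φ : ℝⁿ → ℝ` at `x`, as a vector in `Fin n → ℝ`. -/
def gradE (n : ℕ) (φ : EuclideanSpace ℝ (Fin n) → ℝ) (x : EuclideanSpace ℝ (Fin n)) :
    Fin n → ℝ :=
  fun i => fderiv ℝ φ x (EuclideanSpace.single i 1)

/-- `L₀(ξ, X) = min{⟨Xη, η⟩ : |η| = 1, ⟨ξ, η⟩ = 0}`. -/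
def L0E (n : ℕ) (ξ : Fin n → ℝ) (X : Matrix (Fin n) (Fin n) ℝ) : ℝ :=
  sInf {m : ℝ | ∃ η : Fin n → ℝ, ∑ i, η i ^ 2 = 1 ∧ ∑ i, ξ i * η i = 0 ∧
    m = X.mulVec η ⬝ᵥ η}

/-- Upper semicontinuous envelope `L₀*(ξ, X) = limsup_{(ζ,Y)→(ξ,X)} L₀(ζ,Y)`. -/
def L0starE (n : ℕ) (ξ : Fin n → ℝ) (X : Matrix (Fin n) (Fin n) ℝ) : ℝ :=
  limsup (fun q : (Fin n → ℝ) × Matrix (Fin n) (Fin n) ℝ => L0E n q.1 q.2) (𝓝 (ξ, X))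


/-- A vector `η ≠ 0` orthogonal to `ξ` bounds `L₀(ξ, X)` by its Rayleigh quotient. -/
theorem L0E_le_rayleigh (n : ℕ) (ξ : Fin n → ℝ) (X : Matrix (Fin n) (Fin n) ℝ) (η : Fin n → ℝ)
    (hη : 0 < η ⬝ᵥ η) (hort : ξ ⬝ᵥ η = 0) :
    L0E n ξ X ≤ (X.mulVec η ⬝ᵥ η) / (η ⬝ᵥ η) := by
  set s := Real.sqrt (η ⬝ᵥ η) with hs
  have hs0 : 0 < s := Real.sqrt_pos.2 hη
  have hss : s * s = η ⬝ᵥ η := Real.mul_self_sqrt hη.le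
  refine csInf_le ⟨-∑ i, ∑ j, |X i j|, ?_⟩ ⟨s⁻¹ • η, ?_, ?_, ?_⟩
  · rintro m ⟨v, hv, -, rfl⟩
    have hv1 : ∀ i, |v i| ≤ 1 := fun i => by
      rw [← sq_le_one_iff_abs_le_one, ← hv]
      exact Finset.single_le_sum (f := fun i => v i ^ 2) (fun j _ => sq_nonneg _)
        (Finset.mem_univ i)
    simp only [dotProduct, mulVec, Finset.sum_mul, ← Finset.sum_neg_distrib]
    refine Finset.sum_le_sum fun i _ => Finset.sum_le_sum fun j _ => ?_
    have : |X i j * v j * v i| ≤ |X i j| := by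
      rw [abs_mul, abs_mul, mul_assoc]
      exact mul_le_of_le_one_right (abs_nonneg _)
        (mul_le_one₀ (hv1 j) (abs_nonneg _) (hv1 i))
    exact (neg_le_neg this).trans (neg_abs_le _)
  · have : ∑ i, (s⁻¹ • η) i ^ 2 = (s⁻¹ • η) ⬝ᵥ (s⁻¹ • η) :=
      Finset.sum_congr rfl fun i _ => sq _
    rw [this, smul_dotProduct, dotProduct_smul, ← hss, smul_eq_mul, smul_eq_mul]
    field_simp
  · change ξ ⬝ᵥ (s⁻¹ • η) = 0
    rw [dotProduct_smul, hort, smul_zero]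
  · rw [mulVec_smul, smul_dotProduct, dotProduct_smul, ← hss, smul_eq_mul, smul_eq_mul]
    field_simp

/-- At `ξ ≠ 0`, a direction orthogonal to `ξ` in which the quadratic form of `X` is negative makes
the upper semicontinuous envelope `L₀*(ξ, X)` negative. -/
theorem L0starE_neg (n : ℕ) (ξ : Fin n → ℝ) (X : Matrix (Fin n) (Fin n) ℝ) (η : Fin n → ℝ)
    (hξ : ξ ≠ 0) (hort : ξ ⬝ᵥ η = 0) (hneg : X.mulVec η ⬝ᵥ η < 0) :
    L0starE n ξ X < 0 := by
  have hη : 0 < η ⬝ᵥ η := by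
    refine lt_of_le_of_ne (Finset.sum_nonneg fun i _ => mul_self_nonneg _) fun h => ?_
    rw [(dotProduct_self_eq_zero.1 h.symm)] at hneg
    simp at hneg
  have hξ' : ξ ⬝ᵥ ξ ≠ 0 := fun h => hξ (dotProduct_self_eq_zero.1 h)
  obtain ⟨p, hp0, hp, hport⟩ : ∃ p : (Fin n → ℝ) × Matrix (Fin n) (Fin n) ℝ → Fin n → ℝ,
      p (ξ, X) = η ∧ ContinuousAt p (ξ, X) ∧ ∀ᶠ q in 𝓝 (ξ, X), q.1 ⬝ᵥ p q = 0 := by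
    have h1 : ContinuousAt (fun q : (Fin n → ℝ) × Matrix (Fin n) (Fin n) ℝ => q.1 ⬝ᵥ q.1)
        (ξ, X) := by
      simp only [dotProduct]; fun_prop
    have h2 : ContinuousAt (fun q : (Fin n → ℝ) × Matrix (Fin n) (Fin n) ℝ => q.1 ⬝ᵥ η)
        (ξ, X) := by
      simp only [dotProduct]; fun_prop
    refine ⟨fun q => η - ((q.1 ⬝ᵥ η) / (q.1 ⬝ᵥ q.1)) • q.1, by simp [hort],
      continuousAt_const.sub ((h2.div h1 hξ').smul continuousAt_fst), ?_⟩
    filter_upwards [h1.eventually_ne hξ'] with q hq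
    rw [dotProduct_sub, dotProduct_smul, smul_eq_mul, div_mul_cancel₀ _ hq, sub_self]
  have hpp : ContinuousAt (fun q => p q ⬝ᵥ p q) (ξ, X) := by
    have : Continuous fun v : Fin n → ℝ => v ⬝ᵥ v := by simp only [dotProduct]; fun_prop
    exact (this.tendsto _).comp hp
  have hXp : ContinuousAt (fun q : (Fin n → ℝ) × Matrix (Fin n) (Fin n) ℝ =>
      q.2.mulVec (p q) ⬝ᵥ p q) (ξ, X) := by
    have hpi : ∀ i, ContinuousAt (fun q => p q i) (ξ, X) := fun i => continuousAt_pi.1 hp i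
    simp only [dotProduct, mulVec]
    fun_prop
  have hR := hXp.div hpp (by rw [hp0]; exact hη.ne')
  have hval : X.mulVec η ⬝ᵥ η / (η ⬝ᵥ η) < 0 := div_neg_of_neg_of_pos hneg hη
  obtain ⟨c, hc, hc0⟩ := exists_between hval
  refine lt_of_le_of_lt (limsup_le_of_le ?_ ?_) hc0
  · refine ⟨L0E n ξ X, fun a ha => ?_⟩
    exact (Filter.eventually_map.1 ha).self_of_nhds
  · have e1 := hR.eventually_lt (continuousAt_const (y := c)) (by simpa [hp0] using hc)
    have e2 := (continuousAt_const (y := (0 : ℝ))).eventually_lt hpp (by simpa [hp0] using hη)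
    filter_upwards [e1, e2, hport] with q hq1 hq2 hq3
    exact (L0E_le_rayleigh n q.1 q.2 (p q) hq2 hq3).trans hq1.le

theorem gradE_dotProduct (n : ℕ) (φ : EuclideanSpace ℝ (Fin n) → ℝ)
    (x v : EuclideanSpace ℝ (Fin n)) : gradE n φ x ⬝ᵥ v.ofLp = fderiv ℝ φ x v := by
  have hv : v = ∑ i, v i • EuclideanSpace.single i (1 : ℝ) := by
    simpa using ((EuclideanSpace.basisFun (Fin n) ℝ).sum_repr v).symm
  conv_rhs => rw [hv]
  simp [gradE, dotProduct, mul_comm]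

theorem hessE_mulVec_dotProduct (n : ℕ) (φ : EuclideanSpace ℝ (Fin n) → ℝ)
    (hφ : ContDiff ℝ (⊤ : ℕ∞) φ) (x v : EuclideanSpace ℝ (Fin n)) :
    (hessE n φ x).mulVec v.ofLp ⬝ᵥ v.ofLp = fderiv ℝ (fun y => fderiv ℝ φ y v) x v := by
  have hv : v = ∑ i, v i • EuclideanSpace.single i (1 : ℝ) := by
    simpa using ((EuclideanSpace.basisFun (Fin n) ℝ).sum_repr v).symm
  have hd : DifferentiableAt ℝ (fderiv ℝ φ) x :=
    ((hφ.fderiv_right (m := 1) (by norm_cast)).differentiable one_ne_zero) x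
  have hap : ∀ u w : EuclideanSpace ℝ (Fin n),
      fderiv ℝ (fun y => fderiv ℝ φ y u) x w = fderiv ℝ (fderiv ℝ φ) x w u := fun u w => by
    rw [fderiv_clm_apply hd (differentiableAt_const u)]
    simp
  rw [hap]
  conv_rhs => rw [hv]
  simp only [hessE, hap, dotProduct, mulVec, map_sum, map_smul, _root_.sum_apply,
    _root_.smul_apply, smul_eq_mul, Finset.sum_mul, Finset.mul_sum]
  refine Finset.sum_comm.trans ?_
  refine Finset.sum_congr rfl fun i _ => Finset.sum_congr rfl fun j _ => ?_
  ring

open scoped RealInnerProductSpace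

section TestFunction

variable {E : Type*} [NormedAddCommGroup E] [InnerProductSpace ℝ E]

/-- Squared distance to the line through `z` in the unit direction `u`. -/
def lineDistSq (u z w : E) : ℝ := ‖w - z‖ ^ 2 - ⟪u, w - z⟫ ^ 2

/-- Steep away from the line through `z` in direction `u`, slightly concave along it, with a quartic
correction at `p` making the maxima at `p` strict. -/
def ridgeFn (u z p : E) (c ε : ℝ) (m : ℕ) (w : E) : ℝ :=
  c * lineDistSq u z w ^ (m + 2) - ε * ⟪u, w - z⟫ ^ 2 + (‖w - p‖ ^ 2) ^ 2

theorem lineDistSq_eq_norm_sq {u : E} (hu : ‖u‖ = 1) (z w : E) :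
    lineDistSq u z w = ‖w - z - ⟪u, w - z⟫ • u‖ ^ 2 := by
  rw [norm_sub_sq_real, inner_smul_right, norm_smul, hu, real_inner_comm u, mul_one,
    Real.norm_eq_abs, sq_abs, lineDistSq]
  ring

theorem lineDistSq_nonneg {u : E} (hu : ‖u‖ = 1) (z w : E) : 0 ≤ lineDistSq u z w :=
  lineDistSq_eq_norm_sq hu z w ▸ sq_nonneg _

theorem contDiff_lineDistSq (u z : E) {k : WithTop ℕ∞} : ContDiff ℝ k (lineDistSq u z) :=
  ((contDiff_id.sub contDiff_const).norm_sq ℝ).sub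
    ((contDiff_const.inner ℝ (contDiff_id.sub contDiff_const)).pow 2)

theorem contDiff_ridgeFn (u z p : E) (c ε : ℝ) (m : ℕ) {k : WithTop ℕ∞} :
    ContDiff ℝ k (ridgeFn u z p c ε m) :=
  ((contDiff_const.mul ((contDiff_lineDistSq u z).pow _)).sub (contDiff_const.mul
    ((contDiff_const.inner ℝ (contDiff_id.sub contDiff_const)).pow 2))).add
      (((contDiff_id.sub contDiff_const).norm_sq ℝ).pow 2)

theorem hasDerivAt_line (z w v : E) : HasDerivAt (fun t : ℝ => w + t • v - z) v 0 := by
  simpa using (((hasDerivAt_id (0 : ℝ)).smul_const v).const_add w).sub_const z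

theorem hasDerivAt_line_inner (a z w v : E) :
    HasDerivAt (fun t : ℝ => ⟪a, w + t • v - z⟫) ⟪a, v⟫ 0 := by
  simpa using (hasDerivAt_const (0 : ℝ) a).inner ℝ (hasDerivAt_line z w v)

theorem hasDerivAt_line_norm_sq (z w v : E) :
    HasDerivAt (fun t : ℝ => ‖w + t • v - z‖ ^ 2) (2 * ⟪w - z, v⟫) 0 := by
  simpa using (hasDerivAt_line z w v).norm_sq

theorem hasDerivAt_line_lineDistSq (u z w v : E) :
    HasDerivAt (fun t : ℝ => lineDistSq u z (w + t • v))
      (2 * (⟪w - z, v⟫ - ⟪u, w - z⟫ * ⟪u, v⟫)) 0 := by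
  refine ((hasDerivAt_line_norm_sq z w v).sub
    ((hasDerivAt_line_inner u z w v).pow 2)).congr_deriv ?_
  simp only [zero_smul, add_zero]
  push_cast
  ring

theorem fderiv_apply_eq_of_hasDerivAt {g : E → ℝ} {w v : E} {a : ℝ}
    (hg : DifferentiableAt ℝ g w) (h : HasDerivAt (fun t : ℝ => g (w + t • v)) a 0) :
    fderiv ℝ g w v = a := by
  rw [← hg.lineDeriv_eq_fderiv]
  exact h.deriv

theorem fderiv_ridgeFn (u z p : E) (c ε : ℝ) (m : ℕ) (w v : E) :
    fderiv ℝ (ridgeFn u z p c ε m) w v =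
      c * (m + 2) * lineDistSq u z w ^ (m + 1) * (2 * (⟪w - z, v⟫ - ⟪u, w - z⟫ * ⟪u, v⟫))
        - 2 * ε * ⟪u, w - z⟫ * ⟪u, v⟫ + 4 * ‖w - p‖ ^ 2 * ⟪w - p, v⟫ := by
  refine fderiv_apply_eq_of_hasDerivAt
    ((contDiff_ridgeFn u z p c ε m (k := 1)).differentiable one_ne_zero w) ?_
  refine (((((hasDerivAt_line_lineDistSq u z w v).pow (m + 2)).const_mul c).sub
    (((hasDerivAt_line_inner u z w v).pow 2).const_mul ε)).add
      ((hasDerivAt_line_norm_sq p w v).pow 2)).congr_deriv ?_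
  simp only [zero_smul, add_zero, Nat.add_succ_sub_one]
  push_cast
  ring

theorem fderiv_fderiv_ridgeFn (u z p : E) (c ε : ℝ) (m : ℕ) (v : E) :
    fderiv ℝ (fun w => fderiv ℝ (ridgeFn u z p c ε m) w v) p v =
      c * (m + 2) * ((m + 1) * lineDistSq u z p ^ m *
        (2 * (⟪p - z, v⟫ - ⟪u, p - z⟫ * ⟪u, v⟫)) ^ 2
        + lineDistSq u z p ^ (m + 1) * (2 * (‖v‖ ^ 2 - ⟪u, v⟫ ^ 2))) - 2 * ε * ⟪u, v⟫ ^ 2 := by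
  refine fderiv_apply_eq_of_hasDerivAt ?_ ?_
  · exact ((((contDiff_ridgeFn u z p c ε m (k := 2)).fderiv_right (m := 1) le_rfl).clm_apply
      contDiff_const).differentiable one_ne_zero) p
  simp only [fderiv_ridgeFn]
  have hv := hasDerivAt_line_inner v z p v
  have hp := hasDerivAt_line_inner v p p v
  simp only [real_inner_comm _ v] at hv hp
  have hu := hasDerivAt_line_inner u z p v
  refine ((((((hasDerivAt_line_lineDistSq u z p v).pow (m + 1)).const_mul (c * (m + 2))).mul
    ((hv.sub (hu.mul_const ⟪u, v⟫)).const_mul 2)).sub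
      ((hu.const_mul (2 * ε)).mul_const ⟪u, v⟫)).add
        (((hasDerivAt_line_norm_sq p p v).const_mul 4).mul hp)).congr_deriv ?_
  simp only [zero_smul, add_zero, Nat.add_succ_sub_one, Pi.sub_apply, Pi.pow_apply, sub_self,
    inner_zero_left, norm_zero, real_inner_self_eq_norm_sq]
  push_cast
  ring

/-- Where the radial part of `ridgeFn` dominates its concave part, some direction tangent to the
level set has negative second derivative, and the gradient does not vanish. -/
theorem exists_fderiv_ridgeFn_neg {u z p : E} {c ε : ℝ} {m : ℕ} (hu : ‖u‖ = 1) (hc : 0 < c)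
    (hε : 0 < ε) (hp : 0 < lineDistSq u z p)
    (hle : 2 * (ε * ⟪u, p - z⟫ ^ 2) ≤ c * lineDistSq u z p ^ (m + 2)) :
    fderiv ℝ (ridgeFn u z p c ε m) p ≠ 0 ∧
      ∃ v : E, fderiv ℝ (ridgeFn u z p c ε m) p v = 0 ∧
        fderiv ℝ (fun w => fderiv ℝ (ridgeFn u z p c ε m) w v) p v < 0 := by
  obtain ⟨d, hd⟩ : ∃ d, d = p - z - ⟪u, p - z⟫ • u := ⟨_, rfl⟩
  have huu : ⟪u, u⟫ = 1 := by rw [real_inner_self_eq_norm_sq, hu, one_pow]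
  have hud : ⟪u, d⟫ = 0 := by
    rw [hd, inner_sub_right, inner_smul_right, huu, mul_one, sub_self]
  have hdd : ⟪d, d⟫ = lineDistSq u z p := by
    rw [real_inner_self_eq_norm_sq, hd, lineDistSq_eq_norm_sq hu]
  have hpd : ⟪p - z, d⟫ = lineDistSq u z p := by
    rw [← hdd, show p - z = d + ⟪u, p - z⟫ • u by rw [hd]; abel, inner_add_left, inner_smul_left,
      hud, mul_zero, add_zero]
  have hpu : ⟪p - z, u⟫ = ⟪u, p - z⟫ := real_inner_comm _ _
  generalize hQ : lineDistSq u z p = Q at *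
  generalize hL : ⟪u, p - z⟫ = ℓ at *
  have hψ : 0 < c * Q ^ (m + 2) := by positivity
  refine ⟨fun h => ?_, u + (ε * ℓ / ((m + 2) * (c * Q ^ (m + 2)))) • d, ?_, ?_⟩
  · have := fderiv_ridgeFn u z p c ε m p d
    rw [h, hpd, hud, hQ, sub_self, norm_zero] at this
    have h2 : 0 < c * (m + 2) * Q ^ (m + 1) * (2 * Q) := by positivity
    simp at this
    simp [hc.ne', hp.ne'] at this
    have h3 : (0 : ℝ) < m + 2 := by positivity
    linarith
  · generalize ht : ε * ℓ / ((m + 2) * (c * Q ^ (m + 2))) = t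
    have ht' : t * ((m + 2) * (c * Q ^ (m + 2))) = ε * ℓ := by
      rw [← ht]; exact div_mul_cancel₀ _ (by positivity)
    rw [fderiv_ridgeFn, inner_add_right, inner_add_right, inner_smul_right, inner_smul_right, hpd,
      hud, huu, hpu, hQ, hL, sub_self, norm_zero]
    linear_combination 2 * ht'
  · have hlt : ε * ℓ / ((m + 2) * (c * Q ^ (m + 2))) * ℓ * (2 * m + 3) < 1 := by
      rw [div_mul_eq_mul_div, div_mul_eq_mul_div, div_lt_one (by positivity)]
      have := mul_le_mul_of_nonneg_right hle (by positivity : (0 : ℝ) ≤ 2 * m + 3)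
      linarith
    generalize ht : ε * ℓ / ((m + 2) * (c * Q ^ (m + 2))) = t at *
    have ht' : t * ((m + 2) * (c * Q ^ (m + 2))) = ε * ℓ := by
      rw [← ht]; exact div_mul_cancel₀ _ (by positivity)
    rw [fderiv_fderiv_ridgeFn, ← real_inner_self_eq_norm_sq]
    simp only [inner_add_right, inner_add_left, inner_smul_right, inner_smul_left, hpd, hud, huu,
      hpu, hQ, hL, hdd, real_inner_comm u d, conj_trivial]
    have := mul_lt_mul_of_pos_left hlt hε
    refine lt_of_eq_of_lt (b := 2 * (ε * (t * ℓ * (2 * m + 3))) - 2 * ε) ?_ (by linarith)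
    linear_combination 2 * t * (2 * m + 3) * ht'

end TestFunction

theorem L0starE_ridgeFn_neg {n : ℕ} {u z p : EuclideanSpace ℝ (Fin n)} {c ε : ℝ} {m : ℕ}
    (hu : ‖u‖ = 1) (hc : 0 < c) (hε : 0 < ε) (hp : 0 < lineDistSq u z p)
    (hle : 2 * (ε * ⟪u, p - z⟫ ^ 2) ≤ c * lineDistSq u z p ^ (m + 2)) :
    L0starE n (gradE n (ridgeFn u z p c ε m) p) (hessE n (ridgeFn u z p c ε m) p) < 0 := by
  obtain ⟨hne, v, hv, hneg⟩ := exists_fderiv_ridgeFn_neg hu hc hε hp hle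
  refine L0starE_neg n _ _ v.ofLp (fun h => hne ?_) ?_ ?_
  · ext w
    rw [← gradE_dotProduct, h, zero_dotProduct, _root_.zero_apply]
  · rw [gradE_dotProduct, hv]
  · rw [hessE_mulVec_dotProduct n _ (contDiff_ridgeFn u z p c ε m)]
    exact hneg

/-- If `f` attains its maximum over a segment at the interior point `z`, with smaller values at the
endpoints, and `z` is not a local maximum of `f`, then some `ridgeFn` touches `f` from above off
the line of the segment. -/
theorem exists_ridgeFn_touching {E : Type*} [NormedAddCommGroup E] [InnerProductSpace ℝ E]
    [ProperSpace E] {Ω : Set E} (hΩ : IsOpen Ω) {f : E → ℝ} (hf : UpperSemicontinuousOn f Ω)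
    {z u : E} {a b : ℝ} (hu : ‖u‖ = 1) (ha : 0 < a) (hb : 0 < b)
    (hmem : ∀ s ∈ Set.Icc (-a) b, z + s • u ∈ Ω)
    (hmax : ∀ s ∈ Set.Icc (-a) b, f (z + s • u) ≤ f z)
    (hfa : f (z + (-a) • u) < f z) (hfb : f (z + b • u) < f z) (hz : ¬ IsLocalMaxOn f Ω z) :
    ∃ (c ε : ℝ) (m : ℕ) (p : E), 0 < c ∧ 0 < ε ∧ p ∈ Ω ∧ 0 < lineDistSq u z p ∧
      2 * (ε * ⟪u, p - z⟫ ^ 2) ≤ c * lineDistSq u z p ^ (m + 2) ∧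
      ∃ U ∈ 𝓝 p, ∀ y ∈ U ∩ Ω, y ≠ p →
        f y - ridgeFn u z p c ε m y < f p - ridgeFn u z p c ε m p := by
  have hQc : Continuous (lineDistSq u z) := (contDiff_lineDistSq u z (k := 0)).continuous
  have hℓc : Continuous fun w : E => ⟪u, w - z⟫ := by fun_prop
  -- a thin compact cylinder in `Ω` around the segment, with small values of `f` on its end caps
  obtain ⟨r, hr, hrmem, hrcpt, hra, hrb⟩ : ∃ r > 0,
      (∀ w, -a ≤ ⟪u, w - z⟫ ∧ ⟪u, w - z⟫ ≤ b ∧ lineDistSq u z w ≤ r ^ 2 → w ∈ Ω) ∧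
      IsCompact {w | -a ≤ ⟪u, w - z⟫ ∧ ⟪u, w - z⟫ ≤ b ∧ lineDistSq u z w ≤ r ^ 2} ∧
      (∀ w, ⟪u, w - z⟫ = -a → lineDistSq u z w ≤ r ^ 2 → f w < f z) ∧
      (∀ w, ⟪u, w - z⟫ = b → lineDistSq u z w ≤ r ^ 2 → f w < f z) := by
    have hS : IsCompact ((fun s : ℝ => z + s • u) '' Set.Icc (-a) b) :=
      isCompact_Icc.image (by fun_prop)
    obtain ⟨δ, hδ, hδΩ⟩ := hS.exists_cthickening_subset_open hΩ (Set.image_subset_iff.2 hmem)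
    have hcap : ∀ s ∈ Set.Icc (-a) b, f (z + s • u) < f z →
        ∃ δ > 0, ∀ w, dist w (z + s • u) < δ → f w < f z := fun s hs h => by
      have := hf _ (hmem s hs) _ h
      rw [hΩ.nhdsWithin_eq (hmem s hs)] at this
      exact Metric.eventually_nhds_iff.1 this
    obtain ⟨δa, hδa, hδa'⟩ := hcap (-a) ⟨le_rfl, by linarith⟩ hfa
    obtain ⟨δb, hδb, hδb'⟩ := hcap b ⟨by linarith, le_rfl⟩ hfb
    obtain ⟨r, hr, hrlt⟩ := exists_between (lt_min hδ (lt_min hδa hδb))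
    obtain ⟨hrδ, hrab⟩ := lt_min_iff.1 hrlt
    obtain ⟨hrδa, hrδb⟩ := lt_min_iff.1 hrab
    have hdist : ∀ w, lineDistSq u z w ≤ r ^ 2 → dist w (z + ⟪u, w - z⟫ • u) ≤ r := by
      intro w hw
      rw [lineDistSq_eq_norm_sq hu] at hw
      rw [dist_eq_norm, ← sub_sub]
      exact (sq_le_sq₀ (norm_nonneg _) hr.le).1 hw
    have hsub : {w | -a ≤ ⟪u, w - z⟫ ∧ ⟪u, w - z⟫ ≤ b ∧ lineDistSq u z w ≤ r ^ 2} ⊆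
        Metric.cthickening r ((fun s : ℝ => z + s • u) '' Set.Icc (-a) b) := fun w hw =>
      Metric.mem_cthickening_of_dist_le w _ r _ ⟨_, ⟨hw.1, hw.2.1⟩, rfl⟩ (hdist w hw.2.2)
    refine ⟨r, hr, fun w hw => hδΩ (Metric.cthickening_mono hrδ.le _ (hsub hw)),
      hS.cthickening.of_isClosed_subset ?_ hsub, fun w hw hQ => hδa' w ?_, fun w hw hQ => hδb' w ?_⟩
    · exact (isClosed_le continuous_const hℓc).inter
        ((isClosed_le hℓc continuous_const).inter (isClosed_le hQc continuous_const))
    · exact hw ▸ (hdist w hQ).trans_lt hrδa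
    · exact hw ▸ (hdist w hQ).trans_lt hrδb
  set C := {w | -a ≤ ⟪u, w - z⟫ ∧ ⟪u, w - z⟫ ≤ b ∧ lineDistSq u z w ≤ r ^ 2} with hC
  have hfC : UpperSemicontinuousOn f C := hf.mono hrmem
  -- the interior of the cylinder, and a nearby point where `f` is larger than at `z`
  have hint : ∀ w, -a < ⟪u, w - z⟫ → ⟪u, w - z⟫ < b → lineDistSq u z w < r ^ 2 →
      ∀ᶠ y in 𝓝 w, -a < ⟪u, y - z⟫ ∧ ⟪u, y - z⟫ < b ∧ lineDistSq u z y < r ^ 2 :=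
    fun w h1 h2 h3 => (continuousAt_const.eventually_lt hℓc.continuousAt h1).and
      ((hℓc.continuousAt.eventually_lt continuousAt_const h2).and
        (hQc.continuousAt.eventually_lt continuousAt_const h3))
  obtain ⟨q, hq, hfq⟩ : ∃ q, (-a < ⟪u, q - z⟫ ∧ ⟪u, q - z⟫ < b ∧ lineDistSq u z q < r ^ 2) ∧
      f z < f q := by
    have h1 := hint z (by simpa using ha) (by simpa using hb) (by simp [lineDistSq]; positivity)
    by_contra! h
    exact hz (Filter.Eventually.filter_mono nhdsWithin_le_nhds (h1.mono h))
  have hqC : q ∈ C := ⟨hq.1.le, hq.2.1.le, hq.2.2.le⟩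
  obtain ⟨x₀, hx₀, hx₀max⟩ := hfC.exists_isMaxOn ⟨q, hqC⟩ hrcpt
  set B := f x₀ - f z + 1 with hB
  have hBq : f q ≤ f x₀ := hx₀max hqC
  have hB0 : 0 < B := by linarith
  have hQ0 := lineDistSq_nonneg (u := u) hu z
  -- a power for which the radial penalty at `q` is below the gain in `f`
  obtain ⟨m, hm⟩ : ∃ m : ℕ, B / (r ^ 2) ^ (m + 2) * lineDistSq u z q ^ (m + 2) < f q - f z := by
    have hratio0 : 0 ≤ lineDistSq u z q / r ^ 2 := div_nonneg (hQ0 q) (sq_nonneg r)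
    have hratio : lineDistSq u z q / r ^ 2 < 1 := (div_lt_one (by positivity)).2 hq.2.2
    obtain ⟨m, hm⟩ := exists_pow_lt_of_lt_one (div_pos (sub_pos.2 hfq) hB0) hratio
    refine ⟨m, ?_⟩
    have h1 := (pow_le_pow_of_le_one hratio0 hratio.le (Nat.le_add_right m 2)).trans_lt hm
    rw [lt_div_iff₀ hB0, div_pow] at h1
    calc _ = _ := by ring
      _ < _ := h1
  set c := B / (r ^ 2) ^ (m + 2) with hc
  have hc0 : 0 < c := by positivity
  set g := (f q - f z - c * lineDistSq u z q ^ (m + 2)) / 2 with hg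
  have hg0 : 0 < g := by rw [hg]; linarith
  -- high values of `f` in the cylinder stay away from the line
  obtain ⟨δ, hδ, hδK⟩ : ∃ δ > 0, ∀ w ∈ C, f z + g ≤ f w → δ ≤ lineDistSq u z w := by
    have hK := hfC.isCompact_inter_preimage_Ici hrcpt (f z + g)
    have hqK : q ∈ C ∩ f ⁻¹' Set.Ici (f z + g) := by
      refine ⟨hqC, ?_⟩
      have : 0 ≤ c * lineDistSq u z q ^ (m + 2) := mul_nonneg hc0.le (pow_nonneg (hQ0 q) _)
      change f z + g ≤ f q
      linarith
    obtain ⟨w₀, hw₀, hmin⟩ := hK.exists_isMinOn ⟨q, hqK⟩ hQc.continuousOn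
    refine ⟨lineDistSq u z w₀, (hQ0 w₀).lt_of_ne fun h => ?_, fun w hw hfw => hmin ⟨hw, hfw⟩⟩
    have hw₀' : z + ⟪u, w₀ - z⟫ • u = w₀ := by
      rw [lineDistSq_eq_norm_sq hu, eq_comm, sq_eq_zero_iff, norm_eq_zero, sub_sub,
        sub_eq_zero] at h
      exact h.symm
    have h1 := hmax _ ⟨hw₀.1.1, hw₀.1.2.1⟩
    rw [hw₀'] at h1
    have h2 : f z + g ≤ f w₀ := hw₀.2
    linarith
  obtain ⟨ε, hε, hε1, hε2⟩ : ∃ ε > 0, ε * (a + b) ^ 2 < g ∧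
      2 * (ε * (a + b) ^ 2) < c * δ ^ (m + 2) := by
    have h : 0 < min g (c * δ ^ (m + 2) / 2) := lt_min hg0 (by positivity)
    obtain ⟨e, he, he'⟩ := exists_between h
    obtain ⟨h1, h2⟩ := lt_min_iff.1 he'
    have hab : (a + b) ^ 2 ≠ 0 := by positivity
    refine ⟨e / (a + b) ^ 2, by positivity, ?_, ?_⟩ <;> rw [div_mul_cancel₀ _ hab] <;> linarith
  have hℓC : ∀ w ∈ C, ε * ⟪u, w - z⟫ ^ 2 ≤ ε * (a + b) ^ 2 := fun w hw =>
    mul_le_mul_of_nonneg_left (sq_le_sq' (by linarith [hw.1]) (by linarith [hw.2.1])) hε.le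
  have husc : UpperSemicontinuousOn
      (fun w => f w + (ε * ⟪u, w - z⟫ ^ 2 - c * lineDistSq u z w ^ (m + 2))) C :=
    hfC.add (Continuous.upperSemicontinuous (by fun_prop) |>.upperSemicontinuousOn C)
  obtain ⟨p, hpC, hpmax⟩ := husc.exists_isMaxOn ⟨q, hqC⟩ hrcpt
  have hpq := hpmax hqC
  simp only [Set.mem_ofPred_eq] at hpq
  have hψp : 0 ≤ c * lineDistSq u z p ^ (m + 2) := mul_nonneg hc0.le (pow_nonneg (hQ0 p) _)
  have hεq : 0 ≤ ε * ⟪u, q - z⟫ ^ 2 := by positivity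
  have hℓp := hℓC p hpC
  have hfp : f z + g < f p := by linarith
  have hδp := hδK p hpC hfp.le
  have hQp : lineDistSq u z p < r ^ 2 := by
    refine hpC.2.2.lt_of_ne fun h => ?_
    have h1 : c * lineDistSq u z p ^ (m + 2) = B := by
      rw [h, hc]; exact div_mul_cancel₀ _ (by positivity)
    have h2 : f p ≤ f x₀ := hx₀max hpC
    linarith
  have hpa : -a < ⟪u, p - z⟫ :=
    hpC.1.lt_of_ne fun h => by linarith [hra p h.symm hpC.2.2]
  have hpb : ⟪u, p - z⟫ < b :=
    hpC.2.1.lt_of_ne fun h => by linarith [hrb p h hpC.2.2]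
  refine ⟨c, ε, m, p, hc0, hε, hrmem p hpC, hδ.trans_le hδp, ?_, _, hint p hpa hpb hQp, ?_⟩
  · have : c * δ ^ (m + 2) ≤ c * lineDistSq u z p ^ (m + 2) := by gcongr
    linarith
  · rintro y ⟨⟨hy1, hy2, hy3⟩, -⟩ hyp
    have hy : y ∈ C := ⟨hy1.le, hy2.le, hy3.le⟩
    have h1 := hpmax hy
    simp only [Set.mem_ofPred_eq] at h1
    have h2 : 0 < ‖y - p‖ := norm_pos_iff.2 (sub_ne_zero.2 hyp)
    have h3 : 0 < (‖y - p‖ ^ 2) ^ 2 := by positivity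
    simp only [ridgeFn, sub_self, norm_zero]
    linarith

theorem statement0 (n : ℕ) (Ω : Set (EuclideanSpace ℝ (Fin n)))
    (hΩo : IsOpen Ω) (hΩc : Convex ℝ Ω)
    (f : EuclideanSpace ℝ (Fin n) → ℝ)
    (husc : UpperSemicontinuousOn f Ω)
    (hbd : ∀ x ∈ Ω, ∃ U ∈ 𝓝 x, ∃ M : ℝ, ∀ y ∈ U ∩ Ω, |f y| ≤ M)
    (hvisc : ∀ φ : EuclideanSpace ℝ (Fin n) → ℝ, ContDiff ℝ (⊤ : ℕ∞) φ →
      ∀ x ∈ Ω, (∃ U ∈ 𝓝 x, ∀ y ∈ U ∩ Ω, y ≠ x → f y - φ y < f x - φ x) →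
        0 ≤ L0starE n (gradE n φ x) (hessE n φ x))
    (hnomax : ¬ ∃ x ∈ Ω, IsLocalMaxOn f Ω x) :
    ∀ x ∈ Ω, ∀ y ∈ Ω, ∀ l : ℝ, 0 < l → l < 1 →
      f (l • x + (1 - l) • y) ≤ max (f x) (f y) := by
  intro x hx y hy l hl0 hl1
  by_contra! hlt
  have hseg : segment ℝ x y ⊆ Ω := hΩc.segment_subset hx hy
  have hcpt : IsCompact (segment ℝ x y) := by
    rw [segment_eq_image_lineMap]
    exact isCompact_Icc.image AffineMap.lineMap_continuous
  have hl : l • x + (1 - l) • y ∈ segment ℝ x y :=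
    ⟨l, 1 - l, hl0.le, by linarith, by ring, rfl⟩
  obtain ⟨z, hzs, hzmax⟩ := (husc.mono hseg).exists_isMaxOn ⟨_, hl⟩ hcpt
  have hfz : max (f x) (f y) < f z := hlt.trans_le (hzmax hl)
  obtain ⟨hfx, hfy⟩ := max_lt_iff.1 hfz
  have hxy : x ≠ y := by
    rintro rfl
    rw [segment_same, Set.mem_singleton_iff] at hzs
    exact hfx.ne (by rw [hzs])
  obtain ⟨t, ⟨ht0, ht1⟩, rfl⟩ := (segment_eq_image_lineMap ℝ x y ▸ hzs :)
  have hd : 0 < ‖y - x‖ := norm_pos_iff.2 (sub_ne_zero.2 hxy.symm)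
  have ht0' : 0 < t := ht0.lt_of_ne fun h => by simp [← h] at hfx
  have ht1' : t < 1 := ht1.lt_of_ne fun h => by simp [h] at hfy
  have hpt : ∀ s : ℝ, AffineMap.lineMap x y t + s • (‖y - x‖⁻¹ • (y - x)) =
      AffineMap.lineMap x y (t + s * ‖y - x‖⁻¹) := fun s => by
    simp only [AffineMap.lineMap_apply_module']
    module
  have hu : ‖‖y - x‖⁻¹ • (y - x)‖ = 1 := by
    rw [norm_smul, norm_inv, norm_norm, inv_mul_cancel₀ hd.ne']
  have hmem : ∀ s ∈ Set.Icc (-(t * ‖y - x‖)) ((1 - t) * ‖y - x‖),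
      AffineMap.lineMap x y t + s • (‖y - x‖⁻¹ • (y - x)) ∈ segment ℝ x y := by
    rintro s ⟨hs1, hs2⟩
    rw [hpt, segment_eq_image_lineMap, ← div_eq_mul_inv]
    have h1 : -t ≤ s / ‖y - x‖ := by rw [le_div_iff₀ hd]; linarith
    have h2 : s / ‖y - x‖ ≤ 1 - t := by rwa [div_le_iff₀ hd]
    exact ⟨_, ⟨by linarith, by linarith⟩, rfl⟩
  obtain ⟨c, ε, m, p, hc, hε, hpΩ, hQ, hle, hU⟩ := exists_ridgeFn_touching hΩo husc hu
    (mul_pos ht0' hd) (mul_pos (sub_pos.2 ht1') hd) (fun s hs => hseg (hmem s hs))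
    (fun s hs => hzmax (hmem s hs))
    (by rw [hpt, neg_mul, mul_inv_cancel_right₀ hd.ne', add_neg_cancel,
          AffineMap.lineMap_apply_zero]; exact hfx)
    (by rw [hpt, mul_inv_cancel_right₀ hd.ne', add_sub_cancel,
          AffineMap.lineMap_apply_one]; exact hfy)
    (fun h => hnomax ⟨_, hseg hzs, h⟩)
  exact (hvisc _ (contDiff_ridgeFn _ _ p c ε m) p hpΩ hU).not_gt
    (L0starE_ridgeFn_neg hu hc hε hQ hle)
end
end

section
/- Let Ω be an h-convex open set in the Heisenberg group ℍ. If f ∈ USC(Ω) is h-quasiconvex in Ω, then f is a viscosity subsolution of L[f] ≥ 0 in Ω, i.e., whenever f − φ attains a strict local maximum at p̂ ∈ Ω for a smooth function φ: Ω → ℝ, one has L[φ](p̂) ≥ 0. -/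
open Filter Topology

noncomputable section

abbrev Heis := ℝ × ℝ × ℝ

def hMul (p q : Heis) : Heis :=
  (p.1 + q.1, p.2.1 + q.2.1, p.2.2 + q.2.2 + (p.1 * q.2.1 - q.1 * p.2.1) / 2)

def horiz : Set Heis := {h : Heis | h.2.2 = 0}

def hPlane (p : Heis) : Set Heis := {q : Heis | ∃ h ∈ horiz, q = hMul p h}

def hSeg (p q : Heis) : Set Heis :=
  {w : Heis | ∃ l : ℝ, 0 ≤ l ∧ l ≤ 1 ∧ w = l • p + (1 - l) • q}

def HConvex (E : Set Heis) : Prop :=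
  ∀ p ∈ E, ∀ q ∈ E, q ∈ hPlane p → hSeg p q ⊆ E

def HQuasiconvexOn (f : Heis → ℝ) (Ω : Set Heis) : Prop :=
  ∀ p ∈ Ω, ∀ q ∈ Ω, q ∈ hPlane p → ∀ w ∈ hSeg p q, f w ≤ max (f p) (f q)

def X1 (f : Heis → ℝ) (p : Heis) : ℝ :=
  fderiv ℝ f p (1, 0, 0) - p.2.1 / 2 * fderiv ℝ f p (0, 0, 1)

def X2 (f : Heis → ℝ) (p : Heis) : ℝ :=
  fderiv ℝ f p (0, 1, 0) + p.1 / 2 * fderiv ℝ f p (0, 0, 1)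

def gradH (f : Heis → ℝ) (p : Heis) : ℝ × ℝ := (X1 f p, X2 f p)

def hessH (f : Heis → ℝ) (p : Heis) : ℝ × ℝ × ℝ :=
  (X1 (X1 f) p, (X1 (X2 f) p + X2 (X1 f) p) / 2, X2 (X2 f) p)

def L0H (ξ : ℝ × ℝ) (A : ℝ × ℝ × ℝ) : ℝ :=
  sInf {m : ℝ | ∃ η : ℝ × ℝ, η.1 ^ 2 + η.2 ^ 2 = 1 ∧ ξ.1 * η.1 + ξ.2 * η.2 = 0 ∧
    m = A.1 * η.1 ^ 2 + 2 * A.2.1 * η.1 * η.2 + A.2.2 * η.2 ^ 2}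

def Lop (f : Heis → ℝ) (p : Heis) : ℝ := L0H (gradH f p) (hessH f p)

def LbarOp (f : Heis → ℝ) (p : Heis) : ℝ := limsup (Lop f) (𝓝 p)

def LstarOp (f : Heis → ℝ) (p : Heis) : ℝ :=
  limsup (fun q : (ℝ × ℝ) × ℝ × ℝ × ℝ => L0H q.1 q.2) (𝓝 (gradH f p, hessH f p))

def StrictLocalMaxOnSet (g : Heis → ℝ) (Ω : Set Heis) (p : Heis) : Prop :=
  ∃ U ∈ 𝓝 p, ∀ q ∈ U ∩ Ω, q ≠ p → g q < g p

def UniformlyHQuasiconvexOn (f : Heis → ℝ) (Ω : Set Heis) (r₀ lam : ℝ) : Prop :=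
  ∀ r : ℝ, 0 < r → r < r₀ → ∀ p ∈ Ω, ∀ v ∈ horiz, v.1 ^ 2 + v.2.1 ^ 2 = 1 →
    hMul p (r • v) ∈ Ω → hMul p (-(r • v)) ∈ Ω →
    f p ≤ max (f (hMul p (r • v))) (f (hMul p (-(r • v)))) - lam * r ^ 2

def gaugeK (p : Heis) : ℝ := ((p.1 ^ 2 + p.2.1 ^ 2) ^ 2 + 16 * p.2.2 ^ 2) ^ ((1 : ℝ) / 4)


/-- The left-invariant horizontal direction at `q` with horizontal components `η`. -/
def horizDir (η : ℝ × ℝ) (q : Heis) : Heis :=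
  (η.1, η.2, (q.1 * η.2 - η.1 * q.2.1) / 2)

theorem fderiv_horizDir (f : Heis → ℝ) (η : ℝ × ℝ) (q : Heis) :
    fderiv ℝ f q (horizDir η q) = η.1 * X1 f q + η.2 * X2 f q := by
  have h : horizDir η q = η.1 • ((1, 0, 0) : Heis) + η.2 • ((0, 1, 0) : Heis)
      + ((q.1 * η.2 - η.1 * q.2.1) / 2) • ((0, 0, 1) : Heis) := by
    simp [horizDir]
  rw [h]
  simp only [map_add, map_smul, smul_eq_mul, X1, X2]
  ring

theorem horizDir_add_smul (η : ℝ × ℝ) (p : Heis) (t : ℝ) :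
    horizDir η (p + t • horizDir η p) = horizDir η p := by
  simp only [horizDir, Prod.fst_add, Prod.snd_add, Prod.smul_fst, Prod.smul_snd, smul_eq_mul]
  ext <;> dsimp only
  ring

theorem differentiable_X1 {f : Heis → ℝ} (hf : ContDiff ℝ (⊤ : ℕ∞) f) :
    Differentiable ℝ (X1 f) := by
  have h : Differentiable ℝ (fderiv ℝ f) :=
    (hf.fderiv_right (m := 1) (by norm_cast)).differentiable one_ne_zero
  unfold X1
  fun_prop

theorem differentiable_X2 {f : Heis → ℝ} (hf : ContDiff ℝ (⊤ : ℕ∞) f) :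
    Differentiable ℝ (X2 f) := by
  have h : Differentiable ℝ (fderiv ℝ f) :=
    (hf.fderiv_right (m := 1) (by norm_cast)).differentiable one_ne_zero
  unfold X2
  fun_prop

theorem hasDerivAt_comp_horizontal_line {f : Heis → ℝ} (hf : Differentiable ℝ f)
    (η : ℝ × ℝ) (p : Heis) (t : ℝ) :
    HasDerivAt (fun s : ℝ => f (p + s • horizDir η p))
      (η.1 * X1 f (p + t • horizDir η p) + η.2 * X2 f (p + t • horizDir η p)) t := by
  rw [← fderiv_horizDir, horizDir_add_smul]
  have hline : HasDerivAt (fun s : ℝ => p + s • horizDir η p) (horizDir η p) t := by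
    simpa using ((hasDerivAt_id t).smul_const (horizDir η p)).const_add p
  exact (hf _).hasFDerivAt.comp_hasDerivAt t hline

theorem add_smul_horizDir_mem_hPlane (η : ℝ × ℝ) (p : Heis) (s t : ℝ) :
    p + t • horizDir η p ∈ hPlane (p + s • horizDir η p) := by
  refine ⟨((t - s) * η.1, (t - s) * η.2, 0), rfl, ?_⟩
  simp only [hMul, horizDir]
  ext <;> simp <;> ring

/-- A smooth function has a local maximum along a horizontal line on which it is critical with
negative second derivative. -/
theorem isLocalMax_comp_horizontal_line {f : Heis → ℝ} (hf : ContDiff ℝ (⊤ : ℕ∞) f)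
    (η : ℝ × ℝ) (p : Heis) (hgrad : (gradH f p).1 * η.1 + (gradH f p).2 * η.2 = 0)
    (hhess : (hessH f p).1 * η.1 ^ 2 + 2 * (hessH f p).2.1 * η.1 * η.2
      + (hessH f p).2.2 * η.2 ^ 2 < 0) :
    IsLocalMax (fun t : ℝ => f (p + t • horizDir η p)) 0 := by
  have hdiff : Differentiable ℝ f := hf.differentiable (by simp)
  have hderiv := hasDerivAt_comp_horizontal_line hdiff η p
  have hderiv_eq : deriv (fun t : ℝ => f (p + t • horizDir η p)) = fun t =>
      η.1 * X1 f (p + t • horizDir η p) + η.2 * X2 f (p + t • horizDir η p) :=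
    funext fun t => (hderiv t).deriv
  have hderiv2 :=
    ((hasDerivAt_comp_horizontal_line (differentiable_X1 hf) η p 0).const_mul η.1).add
      ((hasDerivAt_comp_horizontal_line (differentiable_X2 hf) η p 0).const_mul η.2)
  simp only [zero_smul, add_zero] at hderiv2
  refine isLocalMax_of_deriv_deriv_neg ?_ ?_ (hderiv 0).continuousAt
  · rw [hderiv_eq]
    refine (HasDerivAt.deriv hderiv2).trans_lt ?_
    simp only [hessH] at hhess
    linarith
  · rw [hderiv_eq]
    simp only [zero_smul, add_zero]
    simp only [gradH] at hgrad
    linarith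

theorem statement1 (Ω : Set Heis) (hΩo : IsOpen Ω) (hΩc : HConvex Ω)
    (f : Heis → ℝ) (husc : UpperSemicontinuousOn f Ω)
    (hqc : HQuasiconvexOn f Ω) :
    ∀ φ : Heis → ℝ, ContDiff ℝ (⊤ : ℕ∞) φ → ∀ p ∈ Ω,
      StrictLocalMaxOnSet (fun q => f q - φ q) Ω p → 0 ≤ Lop φ p := by
  rintro φ hφ p hp ⟨U, hU, hmax⟩
  refine Real.sInf_nonneg ?_
  rintro _ ⟨η, hη, hgrad, rfl⟩
  by_contra! hhess
  have hd : horizDir η p ≠ 0 := by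
    intro h
    have h1 : η.1 = 0 := congrArg Prod.fst h
    have h2 : η.2 = 0 := congrArg (fun q : Heis => q.2.1) h
    simp [h1, h2] at hη
  have hline : Tendsto (fun t : ℝ => p + t • horizDir η p) (𝓝 0) (𝓝 p) := by
    have : Continuous fun t : ℝ => p + t • horizDir η p := by fun_prop
    simpa using this.tendsto 0
  have hev : ∀ᶠ t in 𝓝 (0 : ℝ), p + t • horizDir η p ∈ Ω ∧
      (t ≠ 0 → f (p + t • horizDir η p) < f p) := by
    filter_upwards [hline (hΩo.mem_nhds hp), hline hU,
      isLocalMax_comp_horizontal_line hφ η p hgrad hhess] with t htΩ htU hφt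
    refine ⟨htΩ, fun ht => ?_⟩
    have hlt := hmax _ ⟨htU, htΩ⟩ (by simp [ht, hd])
    simp only [zero_smul, add_zero] at hφt
    linarith
  have hneg : Tendsto (fun t : ℝ => -t) (𝓝 0) (𝓝 0) := by
    simpa using (continuous_neg (G := ℝ)).tendsto 0
  obtain ⟨t, ⟨⟨hΩ₁, hf₁⟩, hΩ₂, hf₂⟩, ht⟩ :=
    (((hev.and (hneg.eventually hev)).filter_mono nhdsWithin_le_nhds).and
      (self_mem_nhdsWithin : {0}ᶜ ∈ 𝓝[≠] (0 : ℝ))).exists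
  have hmid : p ∈ hSeg (p + t • horizDir η p) (p + (-t) • horizDir η p) :=
    ⟨1 / 2, by norm_num, by norm_num, by module⟩
  have hle := hqc _ hΩ₁ _ hΩ₂ (add_smul_horizDir_mem_hPlane η p t (-t)) p hmid
  exact (max_lt (hf₁ ht) (hf₂ (neg_ne_zero.mpr ht))).not_ge hle
end
end

section
/- Let Ω be an h-convex open set in the Heisenberg group ℍ and let f ∈ USC(Ω) be locally bounded. If f is a viscosity subsolution of overline{L[f]} > 0 in Ω (i.e., whenever f − φ attains a strict local maximum at p̂ ∈ Ω for a smooth φ: Ω → ℝ, one has overline{L[φ]}(p̂) > 0), then f is h-quasiconvex in Ω. In particular, if whenever f − φ attains a strict local maximum at p̂ ∈ Ω for smooth φ one has L[φ](p̂) > 0, then f is h-quasiconvex in Ω. -/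
open Filter Topology

noncomputable section

/-- The derivative of `F` along the left-invariant horizontal vector field `a X₁ + b X₂`. -/
def DH (a b : ℝ) (F : Heis → ℝ) (p : Heis) : ℝ :=
  fderiv ℝ F p (a, b, (b * p.1 - a * p.2.1) / 2)

lemma DH_eq (a b : ℝ) (F : Heis → ℝ) (p : Heis) :
    DH a b F p = a * X1 F p + b * X2 F p := by
  have h : ((a, b, (b * p.1 - a * p.2.1) / 2) : Heis) =
      a • ((1, 0, 0) : Heis) + b • ((0, 1, 0) : Heis) +
        ((b * p.1 - a * p.2.1) / 2) • ((0, 0, 1) : Heis) := by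
    simp
  simp only [DH, X1, X2]
  rw [h]
  simp only [map_add, map_smul, smul_eq_mul]
  ring

lemma X1_eq_DH (F : Heis → ℝ) : X1 F = DH 1 0 F := by
  ext p; rw [DH_eq]; ring

lemma X2_eq_DH (F : Heis → ℝ) : X2 F = DH 0 1 F := by
  ext p; rw [DH_eq]; ring

lemma DH_linear (a b a' b' s t : ℝ) (F : Heis → ℝ) (p : Heis) :
    DH (s * a + t * a') (s * b + t * b') F p = s * DH a b F p + t * DH a' b' F p := by
  simp only [DH_eq]; ring

lemma contDiff_DH {F : Heis → ℝ} (hF : ContDiff ℝ (⊤ : ℕ∞) F) (a b : ℝ) :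
    ContDiff ℝ (⊤ : ℕ∞) (DH a b F) := by
  have h1 : ContDiff ℝ (⊤ : ℕ∞) (fderiv ℝ F) := hF.fderiv_right (by norm_cast)
  have h2 : ContDiff ℝ (⊤ : ℕ∞)
      (fun p : Heis => ((a, b, (b * p.1 - a * p.2.1) / 2) : Heis)) := by fun_prop
  exact h1.clm_apply h2

/-- `F` is differentiable, with derivative `G` along `a X₁ + b X₂`. -/
def HasDH (a b : ℝ) (F G : Heis → ℝ) : Prop :=
  Differentiable ℝ F ∧ ∀ p, DH a b F p = G p

namespace HasDH

variable {a b : ℝ} {F G F' G' : Heis → ℝ}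

lemma of_contDiff (hF : ContDiff ℝ (⊤ : ℕ∞) F) : HasDH a b F (DH a b F) :=
  ⟨hF.differentiable (by simp), fun _ => rfl⟩

lemma eq (h : HasDH a b F G) : DH a b F = G := funext h.2

lemma const (c : ℝ) : HasDH a b (fun _ => c) (fun _ => 0) :=
  ⟨by fun_prop, fun p => by simp [DH]⟩

lemma add (h : HasDH a b F G) (h' : HasDH a b F' G') :
    HasDH a b (fun p => F p + F' p) (fun p => G p + G' p) :=
  ⟨h.1.add h'.1, fun p => by
    dsimp only; rw [← h.2, ← h'.2]; simp only [DH]; rw [fderiv_fun_add (h.1 p) (h'.1 p)]; rfl⟩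

lemma mul (h : HasDH a b F G) (h' : HasDH a b F' G') :
    HasDH a b (fun p => F p * F' p) (fun p => G p * F' p + F p * G' p) :=
  ⟨h.1.mul h'.1, fun p => by
    dsimp only; rw [← h.2, ← h'.2]; simp only [DH]; rw [fderiv_fun_mul (h.1 p) (h'.1 p)]
    simp; ring⟩

lemma const_mul (h : HasDH a b F G) (c : ℝ) :
    HasDH a b (fun p => c * F p) (fun p => c * G p) := by
  simpa using (const c).mul h

lemma sub_const (h : HasDH a b F G) (c : ℝ) : HasDH a b (fun p => F p - c) G := by
  simpa [sub_eq_add_neg] using h.add (const (-c))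

lemma pow (h : HasDH a b F G) (n : ℕ) :
    HasDH a b (fun p => F p ^ n) (fun p => n * F p ^ (n - 1) * G p) :=
  ⟨h.1.pow n, fun p => by
    dsimp only; rw [← h.2]; simp only [DH]; rw [fderiv_fun_pow n (h.1 p)]; simp⟩

lemma congr (h : HasDH a b F G) (hG : ∀ p, G p = G' p) : HasDH a b F G' :=
  ⟨h.1, fun p => (h.2 p).trans (hG p)⟩

end HasDH

lemma DH_DH_linear {F : Heis → ℝ} (hF : ContDiff ℝ (⊤ : ℕ∞) F) (a b a' b' s t : ℝ) (p : Heis) :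
    DH (s * a + t * a') (s * b + t * b') (DH (s * a + t * a') (s * b + t * b') F) p =
      s ^ 2 * DH a b (DH a b F) p + s * t * (DH a b (DH a' b' F) p + DH a' b' (DH a b F) p) +
        t ^ 2 * DH a' b' (DH a' b' F) p := by
  have h : DH (s * a + t * a') (s * b + t * b') F =
      fun p => s * DH a b F p + t * DH a' b' F p := funext (DH_linear a b a' b' s t F)
  have key (α β : ℝ) := ((HasDH.of_contDiff (a := α) (b := β) (contDiff_DH hF a b)).const_mul s).add
    ((HasDH.of_contDiff (a := α) (b := β) (contDiff_DH hF a' b')).const_mul t)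
  rw [h, DH_linear, (key a b).2, (key a' b').2]
  ring

lemma sInf_le_of_mem_of_nonneg {S : Set ℝ} {m ε : ℝ} (hm : m ∈ S) (hmε : m ≤ ε) (hε : 0 ≤ ε) :
    sInf S ≤ ε := by
  by_cases h : BddBelow S
  · exact (csInf_le h hm).trans hmε
  · rwa [Real.sInf_of_not_bddBelow h]

/-- A direction annihilating the horizontal gradient bounds `Lop` from above. -/
lemma Lop_le_of_direction {F : Heis → ℝ} (hF : ContDiff ℝ (⊤ : ℕ∞) F) {a b ε : ℝ} {p : Heis}
    (hε : 0 ≤ ε) (hab : 0 < a ^ 2 + b ^ 2) (h1 : DH a b F p = 0)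
    (h2 : DH a b (DH a b F) p ≤ ε * (a ^ 2 + b ^ 2)) : Lop F p ≤ ε := by
  set r := √(a ^ 2 + b ^ 2) with hr
  have hr0 : 0 < r := Real.sqrt_pos.2 hab
  have hr2 : r ^ 2 = a ^ 2 + b ^ 2 := Real.sq_sqrt hab.le
  have hlin := DH_DH_linear hF 1 0 0 1 a b p
  simp only [mul_one, mul_zero, add_zero, zero_add, ← X1_eq_DH, ← X2_eq_DH] at hlin
  rw [DH_eq] at h1
  refine sInf_le_of_mem_of_nonneg (m := DH a b (DH a b F) p / r ^ 2)
    ⟨(a / r, b / r), ?_, ?_, ?_⟩ ?_ hε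
  · simp only; field_simp; linarith
  · simp only [gradH]; field_simp; linarith
  · simp only [hessH, hlin]; field_simp
  · rw [div_le_iff₀ (by positivity), hr2]; exact h2

/-- `Lop F` is asymptotically nonpositive at `p` when, near `p`, the derivative along a fixed
direction is negligible against the one along the orthogonal direction. -/
lemma eventually_Lop_le_of_ratio {F : Heis → ℝ} (hF : ContDiff ℝ (⊤ : ℕ∞) F) {a b : ℝ}
    (hab : 0 < a ^ 2 + b ^ 2) {p : Heis} {δ : Heis → ℝ} (hδ : Tendsto δ (𝓝 p) (𝓝 0))
    (h1 : ∀ᶠ q in 𝓝 p, DH a b F q = δ q * DH (-b) a F q)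
    (h2 : DH a b (DH a b F) p = 0) {ε : ℝ} (hε : 0 < ε) : ∀ᶠ q in 𝓝 p, Lop F q ≤ ε := by
  have c (α β γ κ : ℝ) : Tendsto (DH α β (DH γ κ F)) (𝓝 p) (𝓝 (DH α β (DH γ κ F) p)) :=
    (contDiff_DH (contDiff_DH hF γ κ) α β).continuous.tendsto p
  have hlim : Tendsto (fun q => DH a b (DH a b F) q
      + (-δ q) * (DH a b (DH (-b) a F) q + DH (-b) a (DH a b F) q)
      + δ q ^ 2 * DH (-b) a (DH (-b) a F) q) (𝓝 p) (𝓝 0) := by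
    have := ((c a b a b).add (hδ.neg.mul ((c a b (-b) a).add (c (-b) a a b)))).add
      ((hδ.pow 2).mul (c (-b) a (-b) a))
    simpa [h2] using this
  filter_upwards [h1, hlim.eventually_lt_const (show 0 < ε * (a ^ 2 + b ^ 2) by positivity)]
    with q hq1 hq2
  have hlin := DH_linear a b (-b) a 1 (-δ q) F q
  have hlin2 := DH_DH_linear hF a b (-b) a 1 (-δ q) q
  have hn : (1 * a + -δ q * -b) ^ 2 + (1 * b + -δ q * a) ^ 2 =
      (1 + δ q ^ 2) * (a ^ 2 + b ^ 2) := by ring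
  refine Lop_le_of_direction hF hε.le (a := 1 * a + -δ q * -b) (b := 1 * b + -δ q * a) ?_ ?_ ?_
  · rw [hn]; positivity
  · rw [hlin, hq1]; ring
  · rw [hlin2, hn]
    have : 0 ≤ ε * (δ q ^ 2 * (a ^ 2 + b ^ 2)) := by positivity
    nlinarith

/-- `Lop F` is asymptotically nonpositive where the horizontal Hessian of `F` vanishes. -/
lemma eventually_Lop_le_of_hess {F : Heis → ℝ} (hF : ContDiff ℝ (⊤ : ℕ∞) F) {a b : ℝ}
    (hab : 0 < a ^ 2 + b ^ 2) {p : Heis} (h11 : DH a b (DH a b F) p = 0)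
    (h12 : DH a b (DH (-b) a F) p = 0) (h21 : DH (-b) a (DH a b F) p = 0)
    (h22 : DH (-b) a (DH (-b) a F) p = 0) {ε : ℝ} (hε : 0 < ε) :
    ∀ᶠ q in 𝓝 p, Lop F q ≤ ε := by
  have c (α β γ κ : ℝ) : Tendsto (DH α β (DH γ κ F)) (𝓝 p) (𝓝 (DH α β (DH γ κ F) p)) :=
    (contDiff_DH (contDiff_DH hF γ κ) α β).continuous.tendsto p
  have hlim : Tendsto (fun q => |DH a b (DH a b F) q|
      + |DH a b (DH (-b) a F) q + DH (-b) a (DH a b F) q|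
      + |DH (-b) a (DH (-b) a F) q|) (𝓝 p) (𝓝 0) := by
    have := ((c a b a b).abs.add ((c a b (-b) a).add (c (-b) a a b)).abs).add
      (c (-b) a (-b) a).abs
    simpa [h11, h12, h21, h22] using this
  filter_upwards [hlim.eventually_lt_const (show 0 < ε * (a ^ 2 + b ^ 2) by positivity)]
    with q hq
  obtain ⟨s, t, hst, hstz⟩ : ∃ s t : ℝ, s ^ 2 + t ^ 2 = 1 ∧
      s * DH a b F q + t * DH (-b) a F q = 0 := by
    set A := DH a b F q
    set B := DH (-b) a F q
    by_cases h : A ^ 2 + B ^ 2 = 0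
    · have hA : A = 0 := by nlinarith [sq_nonneg A, sq_nonneg B]
      have hB : B = 0 := by nlinarith [sq_nonneg A, sq_nonneg B]
      exact ⟨1, 0, by norm_num, by simp [hA]⟩
    · have h' : 0 < A ^ 2 + B ^ 2 := lt_of_le_of_ne (by positivity) (Ne.symm h)
      have hr0 : 0 < √(A ^ 2 + B ^ 2) := Real.sqrt_pos.2 h'
      refine ⟨B / √(A ^ 2 + B ^ 2), -A / √(A ^ 2 + B ^ 2), ?_, ?_⟩
      · rw [div_pow, div_pow, Real.sq_sqrt h'.le]; field_simp; ring
      · field_simp; ring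
  have hlin := DH_linear a b (-b) a s t F q
  have hlin2 := DH_DH_linear hF a b (-b) a s t q
  have hn : (s * a + t * -b) ^ 2 + (s * b + t * a) ^ 2 = a ^ 2 + b ^ 2 := by
    linear_combination (a ^ 2 + b ^ 2) * hst
  refine Lop_le_of_direction hF hε.le (a := s * a + t * -b) (b := s * b + t * a) ?_ ?_ ?_
  · rw [hn]; exact hab
  · rw [hlin, hstz]
  · rw [hlin2, hn]
    refine le_trans ?_ hq.le
    have e1 : |s ^ 2| ≤ 1 := by rw [abs_of_nonneg (sq_nonneg s)]; nlinarith [sq_nonneg t]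
    have e2 : |t ^ 2| ≤ 1 := by rw [abs_of_nonneg (sq_nonneg t)]; nlinarith [sq_nonneg s]
    have e3 : |s * t| ≤ 1 := by
      rw [abs_le]; constructor <;> nlinarith [sq_nonneg (s - t), sq_nonneg (s + t)]
    have bd (κ H : ℝ) (hκ : |κ| ≤ 1) : κ * H ≤ |H| :=
      (le_abs_self _).trans (by rw [abs_mul]; exact mul_le_of_le_one_left (abs_nonneg H) hκ)
    exact add_le_add (add_le_add (bd _ _ e1) (bd _ _ e3)) (bd _ _ e2)

/-- Coordinates adapted to the horizontal direction `(a, b)`: `x` is affine along it, `u` and `v`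
are invariant, and the orthogonal field acts as `∂ᵤ + x ∂ᵥ`. -/
structure AdaptedCoords (a b : ℝ) (x u v : Heis → ℝ) : Prop where
  smooth_x : ContDiff ℝ (⊤ : ℕ∞) x
  smooth_u : ContDiff ℝ (⊤ : ℕ∞) u
  smooth_v : ContDiff ℝ (⊤ : ℕ∞) v
  x₁ : HasDH a b x (fun _ => 1)
  x₂ : HasDH (-b) a x (fun _ => 0)
  u₁ : HasDH a b u (fun _ => 0)
  u₂ : HasDH (-b) a u (fun _ => 1)
  v₁ : HasDH a b v (fun _ => 0)
  v₂ : HasDH (-b) a v x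
  inj : ∀ q q', x q = x q' → u q = u q' → v q = v q' → q = q'

/-- The part of the penalty depending only on the two invariant coordinates. -/
def penalty (N u₀ v₀ : ℝ) (u v : Heis → ℝ) (q : Heis) : ℝ :=
  N * (u q ^ 2 + v q ^ 2) ^ 2 + ((u q - u₀) ^ 2 + (v q - v₀) ^ 2) ^ 2

/-- The derivative of the penalty along the orthogonal field. -/
def penaltyU (N u₀ v₀ : ℝ) (x u v : Heis → ℝ) (q : Heis) : ℝ :=
  4 * N * (u q ^ 2 + v q ^ 2) * (u q + x q * v q) +
    4 * ((u q - u₀) ^ 2 + (v q - v₀) ^ 2) * (u q - u₀ + x q * (v q - v₀))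

/-- The derivative of the penalty in the second invariant coordinate. -/
def penaltyV (N u₀ v₀ : ℝ) (u v : Heis → ℝ) (q : Heis) : ℝ :=
  4 * N * (u q ^ 2 + v q ^ 2) * v q + 4 * ((u q - u₀) ^ 2 + (v q - v₀) ^ 2) * (v q - v₀)

namespace AdaptedCoords

variable {a b : ℝ} {x u v : Heis → ℝ} (h : AdaptedCoords a b x u v) (N u₀ v₀ x₀ : ℝ)
include h

lemma contDiff_penalty : ContDiff ℝ (⊤ : ℕ∞) (penalty N u₀ v₀ u v) := by
  have := h.smooth_u; have := h.smooth_v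
  unfold penalty; fun_prop

lemma contDiff_penaltyU : ContDiff ℝ (⊤ : ℕ∞) (penaltyU N u₀ v₀ x u v) := by
  have := h.smooth_x; have := h.smooth_u; have := h.smooth_v
  unfold penaltyU; fun_prop

lemma contDiff_penaltyV : ContDiff ℝ (⊤ : ℕ∞) (penaltyV N u₀ v₀ u v) := by
  have := h.smooth_u; have := h.smooth_v
  unfold penaltyV; fun_prop

lemma penalty₁ : HasDH a b (penalty N u₀ v₀ u v) (fun _ => 0) :=
  (((((h.u₁.pow 2).add (h.v₁.pow 2)).pow 2).const_mul N).add
    ((((h.u₁.sub_const u₀).pow 2).add ((h.v₁.sub_const v₀).pow 2)).pow 2)).congr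
      fun q => by simp

lemma penalty₂ : HasDH (-b) a (penalty N u₀ v₀ u v) (penaltyU N u₀ v₀ x u v) :=
  (((((h.u₂.pow 2).add (h.v₂.pow 2)).pow 2).const_mul N).add
    ((((h.u₂.sub_const u₀).pow 2).add ((h.v₂.sub_const v₀).pow 2)).pow 2)).congr
      fun q => by simp [penaltyU]; ring

lemma penaltyU₁ : HasDH a b (penaltyU N u₀ v₀ x u v) (penaltyV N u₀ v₀ u v) :=
  (((((h.u₁.pow 2).add (h.v₁.pow 2)).const_mul (4 * N)).mul (h.u₁.add (h.x₁.mul h.v₁))).add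
    (((((h.u₁.sub_const u₀).pow 2).add ((h.v₁.sub_const v₀).pow 2)).const_mul 4).mul
      ((h.u₁.sub_const u₀).add (h.x₁.mul (h.v₁.sub_const v₀))))).congr
        fun q => by simp [penaltyV]

lemma penaltyU₂ : HasDH (-b) a (penaltyU N u₀ v₀ x u v) (fun q =>
    8 * N * (u q + x q * v q) ^ 2 + 4 * N * (u q ^ 2 + v q ^ 2) * (1 + x q ^ 2) +
      8 * (u q - u₀ + x q * (v q - v₀)) ^ 2 +
      4 * ((u q - u₀) ^ 2 + (v q - v₀) ^ 2) * (1 + x q ^ 2)) :=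
  (((((h.u₂.pow 2).add (h.v₂.pow 2)).const_mul (4 * N)).mul (h.u₂.add (h.x₂.mul h.v₂))).add
    (((((h.u₂.sub_const u₀).pow 2).add ((h.v₂.sub_const v₀).pow 2)).const_mul 4).mul
      ((h.u₂.sub_const u₀).add (h.x₂.mul (h.v₂.sub_const v₀))))).congr
        fun q => by simp; ring

lemma penaltyV₁ : HasDH a b (penaltyV N u₀ v₀ u v) (fun _ => 0) :=
  (((((h.u₁.pow 2).add (h.v₁.pow 2)).const_mul (4 * N)).mul h.v₁).add
    (((((h.u₁.sub_const u₀).pow 2).add ((h.v₁.sub_const v₀).pow 2)).const_mul 4).mul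
      (h.v₁.sub_const v₀))).congr
        fun q => by simp

lemma quartic₁ : HasDH a b (fun q => (x q - x₀) ^ 4) (fun q => 4 * (x q - x₀) ^ 3) :=
  ((h.x₁.sub_const x₀).pow 4).congr fun q => by simp

lemma quartic₂ : HasDH (-b) a (fun q => (x q - x₀) ^ 4) (fun _ => 0) :=
  ((h.x₂.sub_const x₀).pow 4).congr fun q => by simp

lemma contDiff_penalty_add_quartic :
    ContDiff ℝ (⊤ : ℕ∞) (fun q => penalty N u₀ v₀ u v q + (x q - x₀) ^ 4) :=
  (h.contDiff_penalty N u₀ v₀).add ((h.smooth_x.sub contDiff_const).pow 4)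

lemma penalty_add_quartic₁ : DH a b (fun q => penalty N u₀ v₀ u v q + (x q - x₀) ^ 4) =
    fun q => 4 * (x q - x₀) ^ 3 := by
  rw [((h.penalty₁ N u₀ v₀).add (h.quartic₁ x₀)).eq]; simp

lemma penalty_add_quartic₂ : DH (-b) a (fun q => penalty N u₀ v₀ u v q + (x q - x₀) ^ 4) =
    penaltyU N u₀ v₀ x u v := by
  rw [((h.penalty₂ N u₀ v₀).add (h.quartic₂ x₀)).eq]; simp

lemma penalty_add_quartic₁₁ :
    DH a b (DH a b (fun q => penalty N u₀ v₀ u v q + (x q - x₀) ^ 4)) =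
      fun q => 12 * (x q - x₀) ^ 2 := by
  rw [h.penalty_add_quartic₁, ((((h.x₁.sub_const x₀).pow 3).const_mul 4)).eq]
  ext q; simp; ring

lemma penalty_add_quartic₂₁ (p : Heis) :
    DH (-b) a (DH a b (fun q => penalty N u₀ v₀ u v q + (x q - x₀) ^ 4)) p = 0 := by
  rw [h.penalty_add_quartic₁, ((((h.x₂.sub_const x₀).pow 3).const_mul 4)).eq]
  simp

/-- Near `p`, a penalty can be made strict so that `Lop` stays asymptotically nonpositive. -/
lemma exists_strict_penalty (hab : 0 < a ^ 2 + b ^ 2) (hN : 0 < N) (p : Heis) :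
    ∃ φ : Heis → ℝ, ContDiff ℝ (⊤ : ℕ∞) φ ∧
      φ p = N * (u p ^ 2 + v p ^ 2) ^ 2 ∧
      (∀ q, q ≠ p → N * (u q ^ 2 + v q ^ 2) ^ 2 < φ q) ∧
      ∀ ε > 0, ∀ᶠ q in 𝓝 p, Lop φ q ≤ ε := by
  set σ := penaltyU N (u p) (v p) x u v with hσ
  set τ := penaltyV N (u p) (v p) u v with hτ
  have hσc : Continuous σ := (h.contDiff_penaltyU N (u p) (v p)).continuous
  have hτc : Continuous τ := (h.contDiff_penaltyV N (u p) (v p)).continuous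
  have hxc : Continuous x := h.smooth_x.continuous
  have hx0 (n : ℕ) (hn : n ≠ 0) (c : ℝ) :
      Tendsto (fun q => c * (x q - x p) ^ n) (𝓝 p) (𝓝 0) := by
    have : Continuous (fun q => c * (x q - x p) ^ n) := by fun_prop
    simpa [hn] using this.tendsto p
  have hquartic (q : Heis) (hq : q ≠ p) :
      N * (u q ^ 2 + v q ^ 2) ^ 2 < penalty N (u p) (v p) u v q + (x q - x p) ^ 4 := by
    unfold penalty
    by_contra! hle
    have e0 : 0 ≤ (x q - x p) ^ 4 := by positivity
    have e1 : 0 ≤ ((u q - u p) ^ 2 + (v q - v p) ^ 2) ^ 2 := by positivity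
    have e2 : (x q - x p) ^ 4 = 0 := by linarith
    have e3 : ((u q - u p) ^ 2 + (v q - v p) ^ 2) ^ 2 = 0 := by linarith
    have e4 := pow_eq_zero_iff (two_ne_zero) |>.1 e3
    refine hq (h.inj _ _ (sub_eq_zero.1 (pow_eq_zero_iff (by norm_num) |>.1 e2)) ?_ ?_) <;>
      nlinarith [sq_nonneg (u q - u p), sq_nonneg (v q - v p)]
  have hquartic0 : penalty N (u p) (v p) u v p + (x p - x p) ^ 4 =
      N * (u p ^ 2 + v p ^ 2) ^ 2 := by
    simp [penalty]
  by_cases hs : σ p = 0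
  · by_cases ht : τ p = 0
    · have hu : u p = 0 ∧ v p = 0 := by
        simp only [hσ, hτ, penaltyU, penaltyV, sub_self] at hs ht
        by_cases hz : u p ^ 2 + v p ^ 2 = 0
        · constructor <;> nlinarith [sq_nonneg (u p), sq_nonneg (v p)]
        · have hv : v p = 0 := by
            simpa [hN.ne', hz] using ht
          refine ⟨?_, hv⟩
          rw [hv] at hs hz
          simpa [hN.ne'] using hs
      refine ⟨_, h.contDiff_penalty_add_quartic N (u p) (v p) (x p), hquartic0, hquartic, ?_⟩
      intro ε hε
      refine eventually_Lop_le_of_hess (h.contDiff_penalty_add_quartic N (u p) (v p) (x p)) hab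
        ?_ ?_ ?_ ?_ hε
      · rw [h.penalty_add_quartic₁₁]; simp
      · rw [h.penalty_add_quartic₂, (h.penaltyU₁ N (u p) (v p)).eq]; exact ht
      · exact h.penalty_add_quartic₂₁ _ _ _ _ _
      · rw [h.penalty_add_quartic₂, (h.penaltyU₂ N (u p) (v p)).eq]; simp [hu.1, hu.2]
    · have hσ₁ : HasDH a b σ τ := h.penaltyU₁ N (u p) (v p)
      have hσs : ContDiff ℝ (⊤ : ℕ∞) σ := h.contDiff_penaltyU N (u p) (v p)
      have hφ : ContDiff ℝ (⊤ : ℕ∞) (fun q => penalty N (u p) (v p) u v q + σ q ^ 4) :=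
        (h.contDiff_penalty N (u p) (v p)).add (hσs.pow 4)
      have hκ : Continuous (DH (-b) a σ) := (contDiff_DH hσs (-b) a).continuous
      have d1 : DH a b (fun q => penalty N (u p) (v p) u v q + σ q ^ 4) =
          fun q => 4 * (σ q ^ 3 * τ q) := by
        rw [((h.penalty₁ N (u p) (v p)).add (hσ₁.pow 4)).eq]
        ext q; simp; ring
      have d2 : DH (-b) a (fun q => penalty N (u p) (v p) u v q + σ q ^ 4) =
          fun q => σ q * (1 + 4 * σ q ^ 2 * DH (-b) a σ q) := by
        rw [((h.penalty₂ N (u p) (v p)).add ((HasDH.of_contDiff hσs).pow 4)).eq]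
        ext q; simp; ring
      have d11 : DH a b (DH a b (fun q => penalty N (u p) (v p) u v q + σ q ^ 4)) =
          fun q => 12 * σ q ^ 2 * τ q ^ 2 := by
        rw [d1, (((hσ₁.pow 3).mul (h.penaltyV₁ N (u p) (v p))).const_mul 4).eq]
        ext q; simp [← hτ]; ring
      have hden : Continuous (fun q => 1 + 4 * σ q ^ 2 * DH (-b) a σ q) := by fun_prop
      have hdenp : 1 + 4 * σ p ^ 2 * DH (-b) a σ p = 1 := by simp [hs]
      have hev : ∀ᶠ q in 𝓝 p, 1 + 4 * σ q ^ 2 * DH (-b) a σ q ≠ 0 :=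
        hden.continuousAt.eventually_ne (by rw [hdenp]; exact one_ne_zero)
      refine ⟨_, hφ, by simp [hs, penalty], ?_, ?_⟩
      · intro q hq
        by_contra! hle
        have e0 : 0 ≤ σ q ^ 4 := by positivity
        have e1 : 0 ≤ ((u q - u p) ^ 2 + (v q - v p) ^ 2) ^ 2 := by positivity
        simp only [penalty] at hle
        have e2 : σ q ^ 4 = 0 := by linarith
        have e3 : ((u q - u p) ^ 2 + (v q - v p) ^ 2) ^ 2 = 0 := by linarith
        have e4 := pow_eq_zero_iff (two_ne_zero) |>.1 e3
        have eu : u q = u p := by nlinarith [sq_nonneg (u q - u p), sq_nonneg (v q - v p)]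
        have ev : v q = v p := by nlinarith [sq_nonneg (u q - u p), sq_nonneg (v q - v p)]
        have e5 : σ q = 0 := pow_eq_zero_iff (by norm_num) |>.1 e2
        have e6 : (x q - x p) * τ p = 0 := by
          simp only [hσ, hτ, penaltyU, penaltyV, eu, ev, sub_self] at e5 hs ⊢
          linear_combination e5 - hs
        have e7 := (mul_eq_zero.1 e6).resolve_right ht
        exact hq (h.inj _ _ (sub_eq_zero.1 e7) eu ev)
      · intro ε hε
        refine eventually_Lop_le_of_ratio hφ hab
          (δ := fun q => 4 * σ q ^ 2 * τ q / (1 + 4 * σ q ^ 2 * DH (-b) a σ q)) ?_ ?_ ?_ hε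
        · have hnum : Continuous (fun q => 4 * σ q ^ 2 * τ q) := by fun_prop
          have := (hnum.tendsto p).div (hden.tendsto p) (by rw [hdenp]; exact one_ne_zero)
          simpa [hs, Pi.div_def] using this
        · filter_upwards [hev] with q hq
          rw [d1, d2]; field_simp
        · rw [d11]; simp [hs]
  · refine ⟨_, h.contDiff_penalty_add_quartic N (u p) (v p) (x p), hquartic0, hquartic, ?_⟩
    intro ε hε
    refine eventually_Lop_le_of_ratio (h.contDiff_penalty_add_quartic N (u p) (v p) (x p)) hab
      (δ := fun q => 4 * (x q - x p) ^ 3 / σ q) ?_ ?_ ?_ hε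
    · simpa [Pi.div_def] using (hx0 3 (by norm_num) 4).div (hσc.tendsto p) hs
    · filter_upwards [hσc.continuousAt.eventually_ne hs] with q hq
      rw [h.penalty_add_quartic₁, h.penalty_add_quartic₂, ← hσ]
      field_simp
    · rw [h.penalty_add_quartic₁₁]; simp

end AdaptedCoords

lemma hasDH_fst (α β : ℝ) : HasDH α β (fun q => q.1) (fun _ => α) :=
  ⟨by fun_prop, fun q => by
    have : fderiv ℝ (fun q : Heis => q.1) q = ContinuousLinearMap.fst ℝ ℝ (ℝ × ℝ) :=
      (ContinuousLinearMap.fst ℝ ℝ (ℝ × ℝ)).fderiv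
    simp [DH, this]⟩

lemma hasDH_snd_fst (α β : ℝ) : HasDH α β (fun q => q.2.1) (fun _ => β) :=
  ⟨by fun_prop, fun q => by
    have : fderiv ℝ (fun q : Heis => q.2.1) q =
        (ContinuousLinearMap.fst ℝ ℝ ℝ).comp (ContinuousLinearMap.snd ℝ ℝ (ℝ × ℝ)) :=
      ((ContinuousLinearMap.fst ℝ ℝ ℝ).comp (ContinuousLinearMap.snd ℝ ℝ (ℝ × ℝ))).fderiv
    simp [DH, this]⟩

lemma hasDH_snd_snd (α β : ℝ) :
    HasDH α β (fun q => q.2.2) (fun q => (β * q.1 - α * q.2.1) / 2) :=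
  ⟨by fun_prop, fun q => by
    have : fderiv ℝ (fun q : Heis => q.2.2) q =
        (ContinuousLinearMap.snd ℝ ℝ ℝ).comp (ContinuousLinearMap.snd ℝ ℝ (ℝ × ℝ)) :=
      ((ContinuousLinearMap.snd ℝ ℝ ℝ).comp (ContinuousLinearMap.snd ℝ ℝ (ℝ × ℝ))).fderiv
    simp [DH, this]⟩

/-- The coordinate along the horizontal line through `p` in direction `(a, b)`. -/
def coordX (a b : ℝ) (p q : Heis) : ℝ :=
  (a ^ 2 + b ^ 2)⁻¹ * (a * (q.1 - p.1) + b * (q.2.1 - p.2.1))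

/-- The coordinate orthogonal to the direction `(a, b)`, vanishing at `p`. -/
def coordU (a b : ℝ) (p q : Heis) : ℝ :=
  (a ^ 2 + b ^ 2)⁻¹ * (-b * (q.1 - p.1) + a * (q.2.1 - p.2.1))

/-- The vertical coordinate invariant along the direction `(a, b)`, vanishing at `p`. -/
def coordV (a b : ℝ) (p q : Heis) : ℝ :=
  (a ^ 2 + b ^ 2)⁻¹ * ((q.2.2 - p.2.2) + (1 / 2) * (p.2.1 * q.1 + -p.1 * q.2.1)) +
    (1 / 2) * (coordX a b p q * coordU a b p q)

/-- The point with prescribed adapted coordinates. -/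
def chart (a b : ℝ) (p : Heis) (c : (ℝ × ℝ) × ℝ) : Heis :=
  hMul p (a * c.2 - b * c.1.1, b * c.2 + a * c.1.1,
    (a ^ 2 + b ^ 2) * (c.1.2 - c.2 * c.1.1 / 2))

section chart

variable {a b : ℝ} (hab : 0 < a ^ 2 + b ^ 2) (p : Heis)
include hab

lemma coordX_chart (c : (ℝ × ℝ) × ℝ) : coordX a b p (chart a b p c) = c.2 := by
  simp only [coordX, chart, hMul]; field_simp; ring

lemma coordU_chart (c : (ℝ × ℝ) × ℝ) : coordU a b p (chart a b p c) = c.1.1 := by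
  simp only [coordU, chart, hMul]; field_simp; ring

lemma coordV_chart (c : (ℝ × ℝ) × ℝ) : coordV a b p (chart a b p c) = c.1.2 := by
  rw [coordV, coordX_chart hab, coordU_chart hab]
  simp only [chart, hMul]; field_simp; ring

lemma chart_coord (q : Heis) :
    chart a b p ((coordU a b p q, coordV a b p q), coordX a b p q) = q := by
  ext
  · simp only [chart, hMul, coordX, coordU]; field_simp; ring
  · simp only [chart, hMul, coordX, coordU]; field_simp; ring
  · simp only [chart, hMul, coordV, coordX, coordU]; field_simp; ring

lemma adaptedCoords : AdaptedCoords a b (coordX a b p) (coordU a b p) (coordV a b p) := by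
  have hX (α β : ℝ) : HasDH α β (coordX a b p)
      (fun _ => (a ^ 2 + b ^ 2)⁻¹ * (a * α + b * β)) :=
    ((((hasDH_fst α β).sub_const p.1).const_mul a).add
      (((hasDH_snd_fst α β).sub_const p.2.1).const_mul b)).const_mul _
  have hU (α β : ℝ) : HasDH α β (coordU a b p)
      (fun _ => (a ^ 2 + b ^ 2)⁻¹ * (-b * α + a * β)) :=
    ((((hasDH_fst α β).sub_const p.1).const_mul (-b)).add
      (((hasDH_snd_fst α β).sub_const p.2.1).const_mul a)).const_mul _
  have hV (α β : ℝ) := ((((hasDH_snd_snd α β).sub_const p.2.2).add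
    ((((hasDH_fst α β).const_mul p.2.1).add ((hasDH_snd_fst α β).const_mul (-p.1))).const_mul
      (1 / 2))).const_mul (a ^ 2 + b ^ 2)⁻¹).add (((hX α β).mul (hU α β)).const_mul (1 / 2))
  have sX : ContDiff ℝ (⊤ : ℕ∞) (coordX a b p) := by unfold coordX; fun_prop
  have sU : ContDiff ℝ (⊤ : ℕ∞) (coordU a b p) := by unfold coordU; fun_prop
  refine ⟨sX, sU, by unfold coordV; fun_prop, (hX a b).congr fun q => ?_,
    (hX (-b) a).congr fun q => ?_, (hU a b).congr fun q => ?_, (hU (-b) a).congr fun q => ?_,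
    (hV a b).congr fun q => ?_, (hV (-b) a).congr fun q => ?_, fun q q' h1 h2 h3 => ?_⟩
  · field_simp
  · ring
  · ring
  · field_simp; ring
  · simp only [coordX, coordU]; field_simp; ring
  · simp only [coordX, coordU]; field_simp; ring
  · rw [← chart_coord hab p q, ← chart_coord hab p q', h1, h2, h3]

end chart

lemma continuous_chart (a b : ℝ) (p : Heis) : Continuous (chart a b p) := by
  unfold chart hMul; fun_prop

/-- If `f` is not h-quasiconvex, some smooth function touches it strictly from above at a point
where `Lop` is asymptotically nonpositive. -/
lemma exists_touching_of_not_quasiconvex {Ω : Set Heis} (hΩo : IsOpen Ω) (hΩc : HConvex Ω)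
    {f : Heis → ℝ} (husc : UpperSemicontinuousOn f Ω) (hf : ¬ HQuasiconvexOn f Ω) :
    ∃ φ : Heis → ℝ, ContDiff ℝ (⊤ : ℕ∞) φ ∧ ∃ p ∈ Ω,
      StrictLocalMaxOnSet (fun q => f q - φ q) Ω p ∧ ∀ ε > 0, ∀ᶠ q in 𝓝 p, Lop φ q ≤ ε := by
  simp only [HQuasiconvexOn, not_forall, not_le, max_lt_iff] at hf
  obtain ⟨p, hp, q, hq, hpq, w, hw, hfp, hfq⟩ := hf
  have hseg := hΩc p hp q hq hpq
  obtain ⟨⟨a, b, z⟩, hz, rfl⟩ := hpq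
  obtain rfl : z = 0 := hz
  have hline (t : ℝ) : chart a b p ((0, 0), t) = (1 - t) • p + (1 - (1 - t)) • hMul p (a, b, 0) := by
    ext <;> simp [chart, hMul] <;> ring
  have hline0 : chart a b p ((0, 0), 0) = p := by rw [hline]; simp
  have hline1 : chart a b p ((0, 0), 1) = hMul p (a, b, 0) := by rw [hline]; simp
  have hsegΩ (t : ℝ) (ht : t ∈ Set.Icc (0 : ℝ) 1) : chart a b p ((0, 0), t) ∈ Ω :=
    hseg ⟨1 - t, by linarith [ht.2], by linarith [ht.1], hline t⟩
  obtain ⟨l, hl0, hl1, hl⟩ := hw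
  have hwline : chart a b p ((0, 0), 1 - l) = w := by rw [hline, hl]; simp
  have hab : 0 < a ^ 2 + b ^ 2 := by
    by_contra! hab
    have ha : a = 0 := by nlinarith [sq_nonneg a, sq_nonneg b]
    have hb : b = 0 := by nlinarith [sq_nonneg a, sq_nonneg b]
    have : w = p := by
      rw [← hwline, ha, hb]; ext <;> simp [chart, hMul]
    exact absurd hfp (by rw [this]; exact lt_irrefl _)
  have hc := adaptedCoords hab p
  set x := coordX a b p
  set u := coordU a b p
  set v := coordV a b p
  have hxc : Continuous x := hc.smooth_x.continuous
  have huc : Continuous u := hc.smooth_u.continuous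
  have hvc : Continuous v := hc.smooth_v.continuous
  have hΘ := continuous_chart a b p
  have hend (t : ℝ) (ht : t ∈ Set.Icc (0 : ℝ) 1) (hlt : f (chart a b p ((0, 0), t)) < f w) :
      ∀ᶠ ζ : ℝ × ℝ in 𝓝 (0, 0), f (chart a b p (ζ, t)) < f w := by
    have h1 := husc _ (hsegΩ t ht) _ hlt
    rw [hΩo.nhdsWithin_eq (hsegΩ t ht)] at h1
    have h2 : Continuous fun ζ : ℝ × ℝ => chart a b p (ζ, t) := by fun_prop
    exact (h2.tendsto (0, 0)).eventually h1
  have htube : ∀ᶠ ζ : ℝ × ℝ in 𝓝 (0, 0), ∀ t ∈ Set.Icc (0 : ℝ) 1, chart a b p (ζ, t) ∈ Ω :=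
    isCompact_Icc.eventually_forall_of_forall_eventually fun t ht =>
      hΘ.continuousAt.eventually_mem (hΩo.mem_nhds (hsegΩ t ht))
  obtain ⟨ρ, hρ, hball⟩ := Metric.nhds_basis_closedBall.eventually_iff.1
    (htube.and ((hend 0 (by simp) (by rwa [hline0])).and (hend 1 (by simp) (by rwa [hline1]))))
  set B := Metric.closedBall ((0, 0) : ℝ × ℝ) ρ ×ˢ Set.Icc (0 : ℝ) 1 with hB
  have hBmem (c : (ℝ × ℝ) × ℝ) : c ∈ B ↔ (|c.1.1| ≤ ρ ∧ |c.1.2| ≤ ρ) ∧ 0 ≤ c.2 ∧ c.2 ≤ 1 := by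
    simp [hB, Prod.dist_eq]
  set K := chart a b p '' B with hK
  have hKc : IsCompact K := ((isCompact_closedBall _ _).prod isCompact_Icc).image hΘ
  have hKmem (y : Heis) : y ∈ K ↔ (|u y| ≤ ρ ∧ |v y| ≤ ρ) ∧ 0 ≤ x y ∧ x y ≤ 1 := by
    constructor
    · rintro ⟨c, hcB, rfl⟩
      rw [hBmem] at hcB
      simpa only [x, u, v, coordX_chart hab, coordU_chart hab, coordV_chart hab] using hcB
    · intro hy
      exact ⟨_, (hBmem _).2 hy, chart_coord hab p y⟩
  have hKΩ : K ⊆ Ω := by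
    rintro _ ⟨c, hcB, rfl⟩
    exact (hball hcB.1).1 c.2 hcB.2
  have hwK : w ∈ K := by
    rw [← hwline]
    exact ⟨_, (hBmem _).2 (by simp [hρ.le, hl0, hl1]), rfl⟩
  have huw : u w = 0 := by rw [← hwline]; exact coordU_chart hab p _
  have hvw : v w = 0 := by rw [← hwline]; exact coordV_chart hab p _
  have huscK := husc.mono hKΩ
  obtain ⟨y₁, -, hy₁⟩ := huscK.exists_isMaxOn ⟨w, hwK⟩ hKc
  obtain ⟨N, hN, hNρ⟩ : ∃ N : ℝ, 0 < N ∧ f y₁ - f w < N * ρ ^ 4 := by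
    refine ⟨(|f y₁ - f w| + 1) / ρ ^ 4, by positivity, ?_⟩
    rw [div_mul_cancel₀ _ (by positivity)]
    linarith [le_abs_self (f y₁ - f w)]
  have hψc : Continuous fun y => -(N * (u y ^ 2 + v y ^ 2) ^ 2) := by fun_prop
  obtain ⟨P, hPK, hP⟩ := (huscK.add
    (hψc.upperSemicontinuous.upperSemicontinuousOn K)).exists_isMaxOn ⟨w, hwK⟩ hKc
  have hPw := hP hwK
  simp only [Set.mem_ofPred_eq, huw, hvw] at hPw
  have hfP : f w + N * (u P ^ 2 + v P ^ 2) ^ 2 ≤ f P := by norm_num at hPw; linarith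
  have hψ0 : 0 ≤ N * (u P ^ 2 + v P ^ 2) ^ 2 := by positivity
  have hPmem := (hKmem P).1 hPK
  have hPuv : u P ^ 2 + v P ^ 2 < ρ ^ 2 := by
    by_contra! hge
    have h1 : (ρ ^ 2) ^ 2 ≤ (u P ^ 2 + v P ^ 2) ^ 2 := by gcongr
    have h2 : N * (ρ ^ 2) ^ 2 ≤ N * (u P ^ 2 + v P ^ 2) ^ 2 := by gcongr
    have h3 : f P ≤ f y₁ := hy₁ hPK
    nlinarith
  have hPchart := chart_coord hab p P
  have hPball : (u P, v P) ∈ Metric.closedBall ((0, 0) : ℝ × ℝ) ρ := by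
    simpa [Prod.dist_eq, Real.dist_eq] using hPmem.1
  have hx0 : 0 < x P := by
    refine lt_of_le_of_ne hPmem.2.1 fun h0 => ?_
    have := (hball hPball).2.1
    rw [h0, hPchart] at this
    linarith
  have hx1 : x P < 1 := by
    refine lt_of_le_of_ne hPmem.2.2 fun h1 => ?_
    have := (hball hPball).2.2
    rw [← h1, hPchart] at this
    linarith
  obtain ⟨φ, hφ, hφP, hφlt, hL⟩ := hc.exists_strict_penalty N hab hN P
  refine ⟨φ, hφ, P, hKΩ hPK, ⟨K, ?_, fun y hy hne => ?_⟩, hL⟩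
  · have huv : Continuous fun y => u y ^ 2 + v y ^ 2 := by fun_prop
    filter_upwards [huv.continuousAt.eventually_lt_const hPuv,
      hxc.continuousAt.eventually_const_lt hx0, hxc.continuousAt.eventually_lt_const hx1]
      with y h1 h2 h3
    exact (hKmem y).2 ⟨⟨abs_le_of_sq_le_sq (by nlinarith [sq_nonneg (v y)]) hρ.le,
      abs_le_of_sq_le_sq (by nlinarith [sq_nonneg (u y)]) hρ.le⟩, h2.le, h3.le⟩
  · have h1 := hP hy.1
    have h2 := hφlt y hne
    simp only [Set.mem_ofPred_eq] at h1
    dsimp only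
    linarith

lemma LbarOp_nonpos {φ : Heis → ℝ} {p : Heis} (h : ∀ ε > 0, ∀ᶠ q in 𝓝 p, Lop φ q ≤ ε) :
    LbarOp φ p ≤ 0 := by
  refine le_of_forall_pos_le_add fun ε hε => ?_
  rw [zero_add, LbarOp, limsup_eq]
  exact sInf_le_of_mem_of_nonneg (h ε hε) le_rfl hε.le

theorem statement2 (Ω : Set Heis) (hΩo : IsOpen Ω) (hΩc : HConvex Ω)
    (f : Heis → ℝ) (husc : UpperSemicontinuousOn f Ω)
    (hbd : ∀ p ∈ Ω, ∃ U ∈ 𝓝 p, ∃ M : ℝ, ∀ q ∈ U ∩ Ω, |f q| ≤ M) :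
    ((∀ φ : Heis → ℝ, ContDiff ℝ (⊤ : ℕ∞) φ → ∀ p ∈ Ω,
        StrictLocalMaxOnSet (fun q => f q - φ q) Ω p → 0 < LbarOp φ p) →
      HQuasiconvexOn f Ω) ∧
    ((∀ φ : Heis → ℝ, ContDiff ℝ (⊤ : ℕ∞) φ → ∀ p ∈ Ω,
        StrictLocalMaxOnSet (fun q => f q - φ q) Ω p → 0 < Lop φ p) →
      HQuasiconvexOn f Ω) := by
  constructor
  · intro h
    by_contra hf
    obtain ⟨φ, hφ, p, hp, hmax, hL⟩ := exists_touching_of_not_quasiconvex hΩo hΩc husc hf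
    exact (h φ hφ p hp hmax).not_ge (LbarOp_nonpos hL)
  · intro h
    by_contra hf
    obtain ⟨φ, hφ, p, hp, hmax, hL⟩ := exists_touching_of_not_quasiconvex hΩo hΩc husc hf
    exact (h φ hφ p hp hmax).not_ge
      (le_of_forall_pos_le_add fun ε hε => by simpa using (hL ε hε).self_of_nhds)
end
end

section
/- The smooth function f(x,y,z) = −z⁴ on the Heisenberg group ℍ satisfies L[f](p) = 0 and L*[f](p) = 0 for every p ∈ ℍ, yet f is not h-quasiconvex in ℍ (for instance, p₁ = (1,2,1), p₂ = (1,−2,−1) and q = (1,0,0) satisfy p₂, q ∈ ℍ_{p₁}, q ∈ [p₁,p₂] and f(q) = 0 > −1 = f(p₁) = f(p₂)). -/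
open Filter Topology

noncomputable section

theorem X1_eq_of_hasFDerivAt {f : Heis → ℝ} {f' : Heis →L[ℝ] ℝ} {p : Heis}
    (h : HasFDerivAt f f' p) : X1 f p = f' (1, 0, 0) - p.2.1 / 2 * f' (0, 0, 1) := by
  rw [X1, h.fderiv]

theorem X2_eq_of_hasFDerivAt {f : Heis → ℝ} {f' : Heis →L[ℝ] ℝ} {p : Heis}
    (h : HasFDerivAt f f' p) : X2 f p = f' (0, 1, 0) + p.1 / 2 * f' (0, 0, 1) := by
  rw [X2, h.fderiv]

theorem hasFDerivAt_coord_x (p : Heis) :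
    HasFDerivAt (fun q : Heis => q.1) (ContinuousLinearMap.fst ℝ ℝ (ℝ × ℝ)) p :=
  hasFDerivAt_fst

theorem hasFDerivAt_coord_y (p : Heis) :
    HasFDerivAt (fun q : Heis => q.2.1)
      ((ContinuousLinearMap.fst ℝ ℝ ℝ).comp (ContinuousLinearMap.snd ℝ ℝ (ℝ × ℝ))) p :=
  hasFDerivAt_snd.fst

theorem hasFDerivAt_coord_z (p : Heis) :
    HasFDerivAt (fun q : Heis => q.2.2)
      ((ContinuousLinearMap.snd ℝ ℝ ℝ).comp (ContinuousLinearMap.snd ℝ ℝ (ℝ × ℝ))) p :=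
  hasFDerivAt_snd.snd

theorem X1_neg_z_pow_four :
    X1 (fun p => -p.2.2 ^ 4) = fun p => p.2.1 * p.2.2 ^ 3 * 2 := by
  funext p
  rw [X1_eq_of_hasFDerivAt ((hasFDerivAt_coord_z p).pow 4).fun_neg]
  simp
  ring

theorem X2_neg_z_pow_four :
    X2 (fun p => -p.2.2 ^ 4) = fun p => p.1 * p.2.2 ^ 3 * (-2) := by
  funext p
  rw [X2_eq_of_hasFDerivAt ((hasFDerivAt_coord_z p).pow 4).fun_neg]
  simp
  ring

theorem gradH_neg_z_pow_four (p : Heis) :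
    gradH (fun p => -p.2.2 ^ 4) p = (p.2.1 * p.2.2 ^ 3 * 2, p.1 * p.2.2 ^ 3 * (-2)) := by
  rw [gradH, X1_neg_z_pow_four, X2_neg_z_pow_four]

theorem hessH_neg_z_pow_four (p : Heis) :
    hessH (fun p => -p.2.2 ^ 4) p =
      (-3 * p.2.1 ^ 2 * p.2.2 ^ 2, 3 * p.1 * p.2.1 * p.2.2 ^ 2, -3 * p.1 ^ 2 * p.2.2 ^ 2) := by
  have hy := ((hasFDerivAt_coord_y p).fun_mul ((hasFDerivAt_coord_z p).pow 3)).mul_const 2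
  have hx := ((hasFDerivAt_coord_x p).fun_mul ((hasFDerivAt_coord_z p).pow 3)).mul_const (-2)
  rw [hessH, X1_neg_z_pow_four, X2_neg_z_pow_four, X1_eq_of_hasFDerivAt hy,
    X1_eq_of_hasFDerivAt hx, X2_eq_of_hasFDerivAt hy, X2_eq_of_hasFDerivAt hx]
  simp only [Prod.mk.injEq]
  refine ⟨?_, ?_, ?_⟩ <;> simp <;> ring

/-- In the plane, a nonzero `ξ` has a unique orthogonal direction, which gives `L0H` explicitly. -/
theorem L0H_of_ne_zero {ξ : ℝ × ℝ} (A : ℝ × ℝ × ℝ) (hξ : ξ.1 ^ 2 + ξ.2 ^ 2 ≠ 0) :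
    L0H ξ A = (A.1 * ξ.2 ^ 2 - 2 * A.2.1 * ξ.1 * ξ.2 + A.2.2 * ξ.1 ^ 2) /
      (ξ.1 ^ 2 + ξ.2 ^ 2) := by
  have hpos : 0 < ξ.1 ^ 2 + ξ.2 ^ 2 := lt_of_le_of_ne (by positivity) hξ.symm
  rw [L0H]
  refine (congrArg sInf ?_).trans (csInf_singleton _)
  ext m
  simp only [Set.mem_ofPred_eq, Set.mem_singleton_iff]
  constructor
  · rintro ⟨η, h1, h2, rfl⟩
    have e1 : η.1 ^ 2 * (ξ.1 ^ 2 + ξ.2 ^ 2) = ξ.2 ^ 2 := by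
      linear_combination ξ.2 ^ 2 * h1 + (ξ.1 * η.1 - ξ.2 * η.2) * h2
    have e2 : η.2 ^ 2 * (ξ.1 ^ 2 + ξ.2 ^ 2) = ξ.1 ^ 2 := by
      linear_combination ξ.1 ^ 2 * h1 - (ξ.1 * η.1 - ξ.2 * η.2) * h2
    have e3 : η.1 * η.2 * (ξ.1 ^ 2 + ξ.2 ^ 2) = -(ξ.1 * ξ.2) := by
      linear_combination (ξ.1 * η.2 + ξ.2 * η.1) * h2 - ξ.1 * ξ.2 * h1
    rw [eq_div_iff hξ]
    linear_combination A.1 * e1 + 2 * A.2.1 * e3 + A.2.2 * e2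
  · rintro rfl
    have hs : √(ξ.1 ^ 2 + ξ.2 ^ 2) ^ 2 = ξ.1 ^ 2 + ξ.2 ^ 2 := Real.sq_sqrt hpos.le
    have hs0 : √(ξ.1 ^ 2 + ξ.2 ^ 2) ≠ 0 := (Real.sqrt_pos.2 hpos).ne'
    refine ⟨(ξ.2 / √(ξ.1 ^ 2 + ξ.2 ^ 2), -ξ.1 / √(ξ.1 ^ 2 + ξ.2 ^ 2)), ?_, ?_, ?_⟩
    · simp only [div_pow, hs]
      field_simp
      ring
    · ring
    · nth_rw 1 [← hs]
      field_simp
      ring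

theorem exists_unit_orthogonal (ξ : ℝ × ℝ) :
    ∃ η : ℝ × ℝ, η.1 ^ 2 + η.2 ^ 2 = 1 ∧ ξ.1 * η.1 + ξ.2 * η.2 = 0 := by
  by_cases hξ : ξ.1 ^ 2 + ξ.2 ^ 2 = 0
  · have h1 : ξ.1 = 0 := by nlinarith [sq_nonneg ξ.1, sq_nonneg ξ.2]
    exact ⟨(1, 0), by norm_num, by simp [h1]⟩
  · have hpos : 0 < ξ.1 ^ 2 + ξ.2 ^ 2 := lt_of_le_of_ne (by positivity) (Ne.symm hξ)
    refine ⟨(ξ.2 / √(ξ.1 ^ 2 + ξ.2 ^ 2), -ξ.1 / √(ξ.1 ^ 2 + ξ.2 ^ 2)), ?_, by ring⟩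
    simp only [div_pow, Real.sq_sqrt hpos.le]
    field_simp
    ring

theorem abs_L0H_le (ξ : ℝ × ℝ) (A : ℝ × ℝ × ℝ) :
    |L0H ξ A| ≤ |A.1| + 2 * |A.2.1| + |A.2.2| := by
  have bound : ∀ η : ℝ × ℝ, η.1 ^ 2 + η.2 ^ 2 = 1 →
      |A.1 * η.1 ^ 2 + 2 * A.2.1 * η.1 * η.2 + A.2.2 * η.2 ^ 2| ≤
        |A.1| + 2 * |A.2.1| + |A.2.2| := by
    intro η h
    have h1 : |η.1 ^ 2| ≤ 1 := by rw [abs_of_nonneg (sq_nonneg _)]; nlinarith [sq_nonneg η.2]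
    have h2 : |η.2 ^ 2| ≤ 1 := by rw [abs_of_nonneg (sq_nonneg _)]; nlinarith [sq_nonneg η.1]
    have h3 : |η.1 * η.2| ≤ 1 := by
      rw [abs_le]
      constructor <;> nlinarith [sq_nonneg (η.1 + η.2), sq_nonneg (η.1 - η.2)]
    calc _ ≤ |A.1 * η.1 ^ 2| + |2 * A.2.1 * η.1 * η.2| + |A.2.2 * η.2 ^ 2| := abs_add_three _ _ _
      _ = |A.1| * |η.1 ^ 2| + 2 * |A.2.1| * |η.1 * η.2| + |A.2.2| * |η.2 ^ 2| := by
        rw [mul_assoc (2 * A.2.1), abs_mul (2 * A.2.1),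
          abs_mul A.1, abs_mul A.2.2, abs_mul 2, abs_two]
      _ ≤ |A.1| * 1 + 2 * |A.2.1| * 1 + |A.2.2| * 1 := by gcongr
      _ = _ := by ring
  obtain ⟨η, hη, hξη⟩ := exists_unit_orthogonal ξ
  rw [abs_le, L0H]
  constructor
  · refine le_csInf (Set.nonempty_def.2 ⟨_, η, hη, hξη, rfl⟩) ?_
    rintro m ⟨ζ, hζ, -, rfl⟩
    exact (abs_le.1 (bound ζ hζ)).1
  · refine le_trans (csInf_le ?_ ⟨η, hη, hξη, rfl⟩) (abs_le.1 (bound η hη)).2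
    refine ⟨-(|A.1| + 2 * |A.2.1| + |A.2.2|), ?_⟩
    rintro m ⟨ζ, hζ, -, rfl⟩
    exact (abs_le.1 (bound ζ hζ)).1

theorem L0H_zero_right (ξ : ℝ × ℝ) : L0H ξ 0 = 0 := by
  simpa using abs_L0H_le ξ 0

theorem continuousAt_L0H_of_ne_zero {ξ : ℝ × ℝ} (A : ℝ × ℝ × ℝ) (hξ : ξ.1 ^ 2 + ξ.2 ^ 2 ≠ 0) :
    ContinuousAt (fun q : (ℝ × ℝ) × ℝ × ℝ × ℝ => L0H q.1 q.2) (ξ, A) := by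
  have hc : ContinuousAt (fun q : (ℝ × ℝ) × ℝ × ℝ × ℝ =>
      (q.2.1 * q.1.2 ^ 2 - 2 * q.2.2.1 * q.1.1 * q.1.2 + q.2.2.2 * q.1.1 ^ 2) /
        (q.1.1 ^ 2 + q.1.2 ^ 2)) (ξ, A) := by
    refine ContinuousAt.div (by fun_prop) (by fun_prop) hξ
  refine hc.congr ?_
  have hne : ∀ᶠ q : (ℝ × ℝ) × ℝ × ℝ × ℝ in 𝓝 (ξ, A), q.1.1 ^ 2 + q.1.2 ^ 2 ≠ 0 :=
    ContinuousAt.eventually_ne (by fun_prop) hξ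
  filter_upwards [hne] with q hq using (L0H_of_ne_zero q.2 hq).symm

theorem continuousAt_L0H_zero_right (ξ : ℝ × ℝ) :
    ContinuousAt (fun q : (ℝ × ℝ) × ℝ × ℝ × ℝ => L0H q.1 q.2) (ξ, 0) := by
  have hb : Continuous fun q : (ℝ × ℝ) × ℝ × ℝ × ℝ => |q.2.1| + 2 * |q.2.2.1| + |q.2.2.2| := by
    fun_prop
  rw [ContinuousAt, L0H_zero_right]
  exact squeeze_zero_norm (fun q => abs_L0H_le q.1 q.2) (by simpa using hb.tendsto (ξ, 0))

theorem LstarOp_eq_Lop {f : Heis → ℝ} {p : Heis}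
    (h : ContinuousAt (fun q : (ℝ × ℝ) × ℝ × ℝ × ℝ => L0H q.1 q.2) (gradH f p, hessH f p)) :
    LstarOp f p = Lop f p :=
  h.tendsto.limsup_eq

theorem hessH_neg_z_pow_four_eq_zero {p : Heis}
    (h : (gradH (fun p => -p.2.2 ^ 4) p).1 ^ 2 + (gradH (fun p => -p.2.2 ^ 4) p).2 ^ 2 = 0) :
    hessH (fun p => -p.2.2 ^ 4) p = 0 := by
  rw [gradH_neg_z_pow_four] at h
  have hy : p.2.1 * p.2.2 ^ 3 * 2 = 0 := by nlinarith
  have hx : p.1 * p.2.2 ^ 3 * (-2) = 0 := by nlinarith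
  rw [hessH_neg_z_pow_four]
  by_cases hz : p.2.2 = 0
  · simp [hz]
  · simp_all

theorem Lop_neg_z_pow_four (p : Heis) : Lop (fun p => -p.2.2 ^ 4) p = 0 := by
  by_cases h : (gradH (fun p => -p.2.2 ^ 4) p).1 ^ 2 + (gradH (fun p => -p.2.2 ^ 4) p).2 ^ 2 = 0
  · rw [Lop, hessH_neg_z_pow_four_eq_zero h, L0H_zero_right]
  · rw [Lop, L0H_of_ne_zero _ h, gradH_neg_z_pow_four, hessH_neg_z_pow_four,
      div_eq_zero_iff]
    left
    ring

theorem LstarOp_neg_z_pow_four (p : Heis) : LstarOp (fun p => -p.2.2 ^ 4) p = 0 := by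
  rw [LstarOp_eq_Lop, Lop_neg_z_pow_four]
  by_cases h : (gradH (fun p => -p.2.2 ^ 4) p).1 ^ 2 + (gradH (fun p => -p.2.2 ^ 4) p).2 ^ 2 = 0
  · rw [hessH_neg_z_pow_four_eq_zero h]
    exact continuousAt_L0H_zero_right _
  · exact continuousAt_L0H_of_ne_zero _ h

theorem statement3 (f : Heis → ℝ) (hf : f = fun p => -p.2.2 ^ 4) :
    (∀ p : Heis, Lop f p = 0 ∧ LstarOp f p = 0) ∧
    ¬ HQuasiconvexOn f Set.univ ∧
    (((1, -2, -1) : Heis) ∈ hPlane (1, 2, 1) ∧ ((1, 0, 0) : Heis) ∈ hPlane (1, 2, 1)) ∧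
    ((1, 0, 0) : Heis) ∈ hSeg (1, 2, 1) (1, -2, -1) ∧
    (f (1, 0, 0) = 0 ∧ f (1, 2, 1) = -1 ∧ f (1, -2, -1) = -1) := by
  subst hf
  have hp : ((1, -2, -1) : Heis) ∈ hPlane (1, 2, 1) :=
    ⟨(0, -4, 0), by simp [horiz], by norm_num [hMul]⟩
  have hq : ((1, 0, 0) : Heis) ∈ hPlane (1, 2, 1) :=
    ⟨(0, -2, 0), by simp [horiz], by norm_num [hMul]⟩
  have hs : ((1, 0, 0) : Heis) ∈ hSeg (1, 2, 1) (1, -2, -1) :=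
    ⟨1 / 2, by norm_num, by norm_num, by norm_num⟩
  refine ⟨fun p => ⟨Lop_neg_z_pow_four p, LstarOp_neg_z_pow_four p⟩, fun h => ?_, ⟨hp, hq⟩, hs,
    by norm_num⟩
  have := h _ (Set.mem_univ _) _ (Set.mem_univ _) hp _ hs
  norm_num at this
end
end

section
/- Let g: ℝ → ℝ be a concave continuous function and define f(x,y,z) = x² + y² − g(z) on the Heisenberg group ℍ. Then for every p = (x,y,z) ∈ ℍ, every v ∈ ℍ₀ with |v| = 1 and every r > 0, max{f(p·rv), f(p·rv⁻¹)} ≥ f(p) + r². In particular, f is uniformly h-quasiconvex in ℍ with λ = 1 and any r₀ > 0. -/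
open Filter Topology

noncomputable section

theorem statement6 (g : ℝ → ℝ) (hgc : Continuous g) (hgcc : ConcaveOn ℝ Set.univ g)
    (f : Heis → ℝ) (hf : f = fun p => p.1 ^ 2 + p.2.1 ^ 2 - g p.2.2) :
    (∀ p : Heis, ∀ v ∈ horiz, v.1 ^ 2 + v.2.1 ^ 2 = 1 → ∀ r : ℝ, 0 < r →
      f p + r ^ 2 ≤ max (f (hMul p (r • v))) (f (hMul p (-(r • v))))) ∧
    (∀ r₀ : ℝ, 0 < r₀ → UniformlyHQuasiconvexOn f Set.univ r₀ 1) := by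
  have key : ∀ p : Heis, ∀ v ∈ horiz, v.1 ^ 2 + v.2.1 ^ 2 = 1 → ∀ r : ℝ, 0 < r →
      f p + r ^ 2 ≤ max (f (hMul p (r • v))) (f (hMul p (-(r • v)))) := by
    rintro ⟨x, y, z⟩ ⟨a, b, c⟩ hv hab r -
    obtain rfl : c = 0 := hv
    simp only at hab
    have hmid := hgcc.2 (Set.mem_univ (z + r * (x * b - a * y) / 2))
      (Set.mem_univ (z - r * (x * b - a * y) / 2))
      (by norm_num : (0 : ℝ) ≤ 1 / 2) (by norm_num : (0 : ℝ) ≤ 1 / 2) (by norm_num)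
    simp only [smul_eq_mul] at hmid
    rw [show 1 / 2 * (z + r * (x * b - a * y) / 2) + 1 / 2 * (z - r * (x * b - a * y) / 2) = z
      by ring] at hmid
    have hplus : f (hMul (x, y, z) (r • (a, b, 0))) =
        (x + r * a) ^ 2 + (y + r * b) ^ 2 - g (z + r * (x * b - a * y) / 2) := by
      simp only [hf, hMul, Prod.smul_mk, smul_eq_mul]
      ring_nf
    have hminus : f (hMul (x, y, z) (-(r • (a, b, 0)))) =
        (x - r * a) ^ 2 + (y - r * b) ^ 2 - g (z - r * (x * b - a * y) / 2) := by
      simp only [hf, hMul, Prod.smul_mk, Prod.neg_mk, smul_eq_mul]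
      ring_nf
    have hcenter : f (x, y, z) = x ^ 2 + y ^ 2 - g z := by rw [hf]
    have hr : r ^ 2 * (a ^ 2 + b ^ 2) = r ^ 2 := by rw [hab, mul_one]
    have hleft := le_max_left (f (hMul (x, y, z) (r • (a, b, 0))))
      (f (hMul (x, y, z) (-(r • (a, b, 0)))))
    have hright := le_max_right (f (hMul (x, y, z) (r • (a, b, 0))))
      (f (hMul (x, y, z) (-(r • (a, b, 0)))))
    linarith
  refine ⟨key, fun r₀ _ r hr _ p _ v hv hv1 _ _ => ?_⟩
  linarith [key p v hv hv1 r hr]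
end
end

section
/- Let C₁, C₂ > 0 satisfy C₁C₂ < 8. Let g: ℝ → ℝ be semiconcave with constant C₁, i.e., z ↦ C₁z²/2 − g(z) is convex on ℝ, and define f(x,y,z) = x² + y² − g(z) on the Heisenberg group ℍ and Ω = {(x,y,z) ∈ ℍ : x² + y² < C₂}. Then for every p = (x,y,z) ∈ ℍ, v ∈ ℍ₀ with |v| = 1 and r > 0 such that p·rv, p·rv⁻¹ ∈ Ω, one has max{f(p·rv), f(p·rv⁻¹)} ≥ f(p) + (1 − C₁C₂/8)r². In particular, f is uniformly h-quasiconvex in Ω with λ = 1 − C₁C₂/8 and any r₀ > 0. -/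
open Filter Topology

noncomputable section

/-- The midpoint inequality for a semiconcave function. -/
theorem semiconcave_midpoint_le {C : ℝ} {g : ℝ → ℝ}
    (hg : ConvexOn ℝ Set.univ (fun z => C * z ^ 2 / 2 - g z)) (z d : ℝ) :
    (g (z + d) + g (z - d)) / 2 ≤ g z + C * d ^ 2 / 2 := by
  have h := hg.2 (Set.mem_univ (z + d)) (Set.mem_univ (z - d))
    (by norm_num : (0 : ℝ) ≤ 1 / 2) (by norm_num : (0 : ℝ) ≤ 1 / 2) (by norm_num)
  have hz : (1 / 2 : ℝ) • (z + d) + (1 / 2 : ℝ) • (z - d) = z := by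
    simp only [smul_eq_mul]; ring
  rw [hz] at h
  simp only [smul_eq_mul] at h
  linarith

theorem statement7 (C₁ C₂ : ℝ) (hC₁ : 0 < C₁) (hC₂ : 0 < C₂) (hC : C₁ * C₂ < 8)
    (g : ℝ → ℝ) (hg : ConvexOn ℝ Set.univ (fun z => C₁ * z ^ 2 / 2 - g z))
    (f : Heis → ℝ) (hf : f = fun p => p.1 ^ 2 + p.2.1 ^ 2 - g p.2.2)
    (Ω : Set Heis) (hΩ : Ω = {p : Heis | p.1 ^ 2 + p.2.1 ^ 2 < C₂}) :
    (∀ p : Heis, ∀ v ∈ horiz, v.1 ^ 2 + v.2.1 ^ 2 = 1 → ∀ r : ℝ, 0 < r →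
      hMul p (r • v) ∈ Ω → hMul p (-(r • v)) ∈ Ω →
      f p + (1 - C₁ * C₂ / 8) * r ^ 2 ≤ max (f (hMul p (r • v))) (f (hMul p (-(r • v))))) ∧
    (∀ r₀ : ℝ, 0 < r₀ → UniformlyHQuasiconvexOn f Ω r₀ (1 - C₁ * C₂ / 8)) := by
  have key : ∀ p : Heis, ∀ v ∈ horiz, v.1 ^ 2 + v.2.1 ^ 2 = 1 → ∀ r : ℝ, 0 < r →
      hMul p (r • v) ∈ Ω → hMul p (-(r • v)) ∈ Ω →
      f p + (1 - C₁ * C₂ / 8) * r ^ 2 ≤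
        max (f (hMul p (r • v))) (f (hMul p (-(r • v)))) := by
    rintro ⟨x, y, z⟩ ⟨a, b, c⟩ hv hab r hr hp hm
    obtain rfl : c = 0 := hv
    subst hf hΩ
    simp only [hMul, Set.mem_ofPred_eq, Prod.smul_mk, Prod.neg_mk, smul_eq_mul] at hab hp hm ⊢
    have hmid := semiconcave_midpoint_le hg z (r * (x * b - a * y) / 2)
    have hzp : z + r * 0 + (x * (r * b) - r * a * y) / 2 = z + r * (x * b - a * y) / 2 := by ring
    have hzm : z + -(r * 0) + (x * -(r * b) - -(r * a) * y) / 2 =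
        z - r * (x * b - a * y) / 2 := by ring
    rw [hzp, hzm]
    have hrr : r ^ 2 * (a ^ 2 + b ^ 2) = r ^ 2 := by rw [hab, mul_one]
    have hxy : x ^ 2 + y ^ 2 ≤ C₂ := by nlinarith [sq_nonneg r]
    have hω : (x * b - a * y) ^ 2 ≤ C₂ := by
      have hsum : (x * b - a * y) ^ 2 + (x * a + y * b) ^ 2 = x ^ 2 + y ^ 2 := by
        linear_combination (x ^ 2 + y ^ 2) * hab
      linarith [sq_nonneg (x * a + y * b)]
    have hbound : C₁ * r ^ 2 * (x * b - a * y) ^ 2 ≤ C₁ * r ^ 2 * C₂ := by gcongr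
    have hmax : ∀ s t : ℝ, (s + t) / 2 ≤ max s t := fun s t => by
      linarith [le_max_left s t, le_max_right s t]
    refine le_trans ?_ (hmax _ _)
    linarith
  refine ⟨key, fun r₀ _ r hr _ p _ v hv hv1 hp hm => ?_⟩
  linarith [key p v hv hv1 r hr hp hm]
end
end

section
/- Let Ω be an open set in the Heisenberg group ℍ, let λ > 0 and let f ∈ C²(Ω) satisfy L[f](p) ≥ 2λ for every p ∈ Ω. Then for every compact set K ⊂ Ω and every σ ∈ (0,1) there exists r₀ = r₀(K,σ) > 0 such that for all 0 < r < r₀, all p ∈ K and all v ∈ ℍ₀ with |v| = 1, the points p·rv, p·rv⁻¹ lie in Ω and f(p) ≤ max{f(p·rv), f(p·rv⁻¹)} − σλr². -/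
open Filter Topology

noncomputable section

/-- The vector tangent to the horizontal line `t ↦ p · (t v)`. -/
def horizLift (p v : Heis) : Heis := (v.1, v.2.1, (p.1 * v.2.1 - v.1 * p.2.1) / 2)

lemma hMul_smul_eq (p v : Heis) (hv : v ∈ horiz) (r : ℝ) :
    hMul p (r • v) = p + r • horizLift p v := by
  have h : v.2.2 = 0 := hv
  ext <;> simp [hMul, horizLift, h]
  ring

lemma hMul_neg_smul_eq (p v : Heis) (hv : v ∈ horiz) (r : ℝ) :
    hMul p (-(r • v)) = p + (-r) • horizLift p v := by
  rw [← neg_smul, hMul_smul_eq p v hv]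

lemma horizLift_eq (p v : Heis) :
    horizLift p v = v.1 • ((1, 0, 0) - (p.2.1 / 2) • (0, 0, 1) : Heis)
      + v.2.1 • ((0, 1, 0) + (p.1 / 2) • (0, 0, 1) : Heis) := by
  ext <;> simp [horizLift]
  ring

lemma fderiv_apply_horizLift (f : Heis → ℝ) (p v : Heis) :
    fderiv ℝ f p (horizLift p v) = (gradH f p).1 * v.1 + (gradH f p).2 * v.2.1 := by
  rw [horizLift_eq]
  simp only [map_add, map_sub, map_smul, smul_eq_mul, gradH, X1, X2]
  ring

lemma fderiv_X1 {f : Heis → ℝ} {p : Heis} (h : DifferentiableAt ℝ (fderiv ℝ f) p) (u : Heis) :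
    fderiv ℝ (X1 f) p u = fderiv ℝ (fderiv ℝ f) p u (1, 0, 0)
      - (u.2.1 / 2 * fderiv ℝ f p (0, 0, 1)
        + p.2.1 / 2 * fderiv ℝ (fderiv ℝ f) p u (0, 0, 1)) := by
  have hc : HasFDerivAt (fun q : Heis => q.2.1 / 2)
      ((2 : ℝ)⁻¹ • (ContinuousLinearMap.fst ℝ ℝ ℝ).comp (ContinuousLinearMap.snd ℝ ℝ (ℝ × ℝ))) p := by
    convert ((2 : ℝ)⁻¹ • (ContinuousLinearMap.fst ℝ ℝ ℝ).comp
      (ContinuousLinearMap.snd ℝ ℝ (ℝ × ℝ))).hasFDerivAt using 1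
    ext q
    simp
    ring
  have ha := fun e : Heis => h.hasFDerivAt.clm_apply (hasFDerivAt_const e p)
  have hX := (ha (1, 0, 0)).sub (hc.mul (ha (0, 0, 1)))
  rw [HasFDerivAt.fderiv (f := X1 f) hX]
  simp
  ring

lemma fderiv_X2 {f : Heis → ℝ} {p : Heis} (h : DifferentiableAt ℝ (fderiv ℝ f) p) (u : Heis) :
    fderiv ℝ (X2 f) p u = fderiv ℝ (fderiv ℝ f) p u (0, 1, 0)
      + (u.1 / 2 * fderiv ℝ f p (0, 0, 1)
        + p.1 / 2 * fderiv ℝ (fderiv ℝ f) p u (0, 0, 1)) := by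
  have hc : HasFDerivAt (fun q : Heis => q.1 / 2)
      ((2 : ℝ)⁻¹ • ContinuousLinearMap.fst ℝ ℝ (ℝ × ℝ)) p := by
    convert ((2 : ℝ)⁻¹ • ContinuousLinearMap.fst ℝ ℝ (ℝ × ℝ)).hasFDerivAt using 1
    ext q
    simp
    ring
  have ha := fun e : Heis => h.hasFDerivAt.clm_apply (hasFDerivAt_const e p)
  have hX := (ha (0, 1, 0)).add (hc.mul (ha (0, 0, 1)))
  rw [HasFDerivAt.fderiv (f := X2 f) hX]
  simp
  ring

/-- The second derivative along a horizontal line is the symmetrized horizontal Hessian form. -/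
lemma fderiv_fderiv_apply_horizLift {f : Heis → ℝ} {p : Heis}
    (h : DifferentiableAt ℝ (fderiv ℝ f) p) (v : Heis) :
    fderiv ℝ (fderiv ℝ f) p (horizLift p v) (horizLift p v) =
      (hessH f p).1 * v.1 ^ 2 + 2 * (hessH f p).2.1 * v.1 * v.2.1
        + (hessH f p).2.2 * v.2.1 ^ 2 := by
  rw [horizLift_eq]
  have e1 (g : Heis → ℝ) :
      X1 g p = fderiv ℝ g p (1, 0, 0) - p.2.1 / 2 * fderiv ℝ g p (0, 0, 1) := rfl
  have e2 (g : Heis → ℝ) :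
      X2 g p = fderiv ℝ g p (0, 1, 0) + p.1 / 2 * fderiv ℝ g p (0, 0, 1) := rfl
  simp only [hessH, e1 (X1 f), e1 (X2 f), e2 (X1 f), e2 (X2 f), fderiv_X1 h, fderiv_X2 h]
  simp only [map_add, map_sub, map_smul, smul_eq_mul, add_apply,
    sub_apply, smul_apply]
  ring

lemma L0H_le {ξ η : ℝ × ℝ} (A : ℝ × ℝ × ℝ) (hη : η.1 ^ 2 + η.2 ^ 2 = 1)
    (hξ : ξ.1 * η.1 + ξ.2 * η.2 = 0) :
    L0H ξ A ≤ A.1 * η.1 ^ 2 + 2 * A.2.1 * η.1 * η.2 + A.2.2 * η.2 ^ 2 := by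
  refine csInf_le ⟨-|A.1| - |A.2.1| - |A.2.2|, ?_⟩ ⟨η, hη, hξ, rfl⟩
  rintro m ⟨ζ, hζ, -, rfl⟩
  have h1 : |A.1 * ζ.1 ^ 2| ≤ |A.1| := by
    rw [abs_mul, abs_of_nonneg (sq_nonneg ζ.1)]
    exact mul_le_of_le_one_right (abs_nonneg _) (by nlinarith [sq_nonneg ζ.2])
  have h3 : |A.2.2 * ζ.2 ^ 2| ≤ |A.2.2| := by
    rw [abs_mul, abs_of_nonneg (sq_nonneg ζ.2)]
    exact mul_le_of_le_one_right (abs_nonneg _) (by nlinarith [sq_nonneg ζ.1])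
  have h2 : |A.2.1 * (2 * ζ.1 * ζ.2)| ≤ |A.2.1| := by
    rw [abs_mul]
    refine mul_le_of_le_one_right (abs_nonneg _) (abs_le.2 ⟨?_, ?_⟩)
    · nlinarith [sq_nonneg (ζ.1 + ζ.2)]
    · nlinarith [sq_nonneg (ζ.1 - ζ.2)]
  have e : 2 * A.2.1 * ζ.1 * ζ.2 = A.2.1 * (2 * ζ.1 * ζ.2) := by ring
  rw [e]
  linarith [neg_le_of_abs_le h1, neg_le_of_abs_le h2, neg_le_of_abs_le h3]

lemma tendsto_add_smul_horizLift (p v : Heis) (s : ℝ) :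
    Tendsto (fun z : ℝ × Heis × Heis => z.2.1 + (s * z.1) • horizLift z.2.1 z.2.2)
      (𝓝 (0, p, v)) (𝓝 p) := by
  have h : Continuous fun z : ℝ × Heis × Heis =>
      z.2.1 + (s * z.1) • horizLift z.2.1 z.2.2 := by
    unfold horizLift
    fun_prop
  simpa using h.tendsto (0, p, v)

lemma tendsto_horizLift (p v : Heis) :
    Tendsto (fun z : ℝ × Heis × Heis => horizLift z.2.1 z.2.2)
      (𝓝 (0, p, v)) (𝓝 (horizLift p v)) := by
  have h : Continuous fun z : ℝ × Heis × Heis => horizLift z.2.1 z.2.2 := by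
    unfold horizLift
    fun_prop
  exact h.tendsto (0, p, v)

/-- Strict differentiability, read along short horizontal segments near `p`. -/
lemma eventually_norm_sub_le {F : Type*} [NormedAddCommGroup F] [NormedSpace ℝ F]
    {g : Heis → F} {g' : Heis →L[ℝ] F} {p : Heis} (hg : HasStrictFDerivAt g g' p) (v : Heis)
    (s s' : ℝ) {ε : ℝ} (hε : 0 < ε) :
    ∀ᶠ z : ℝ × Heis × Heis in 𝓝 (0, p, v),
      ‖g (z.2.1 + (s * z.1) • horizLift z.2.1 z.2.2)
        - g (z.2.1 + (s' * z.1) • horizLift z.2.1 z.2.2)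
        - ((s - s') * z.1) • g' (horizLift z.2.1 z.2.2)‖
        ≤ ε * (|(s - s') * z.1| * ‖horizLift z.2.1 z.2.2‖) := by
  have h := hg.isLittleO.def hε
  rw [nhds_prod_eq] at h
  filter_upwards [((tendsto_add_smul_horizLift p v s).prodMk
    (tendsto_add_smul_horizLift p v s')).eventually h] with z hz
  have e : (z.2.1 + (s * z.1) • horizLift z.2.1 z.2.2)
      - (z.2.1 + (s' * z.1) • horizLift z.2.1 z.2.2)
      = ((s - s') * z.1) • horizLift z.2.1 z.2.2 := by
    module
  simp only [e, map_smul, norm_smul, Real.norm_eq_abs] at hz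
  exact hz

/-- First-order case: a positive derivative in the direction `s v` gives linear growth. -/
lemma eventually_add_sq_le_of_pos {f : Heis → ℝ} {f' : Heis →L[ℝ] ℝ} {p v : Heis}
    (hf : HasStrictFDerivAt f f' p) (s c : ℝ) (hpos : 0 < s * f' (horizLift p v)) :
    ∀ᶠ z : ℝ × Heis × Heis in 𝓝 (0, p, v), 0 < z.1 →
      f z.2.1 + c * z.1 ^ 2 ≤ f (z.2.1 + (s * z.1) • horizLift z.2.1 z.2.2) := by
  obtain ⟨ε, hε, hεlt⟩ : ∃ ε : ℝ, 0 < ε ∧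
      ε * (|s| * ‖horizLift p v‖) < s * f' (horizLift p v) := by
    have ht : Tendsto (fun ε : ℝ => ε * (|s| * ‖horizLift p v‖)) (𝓝[>] 0) (𝓝 0) := by
      have : Continuous fun ε : ℝ => ε * (|s| * ‖horizLift p v‖) := by fun_prop
      simpa using (this.tendsto 0).mono_left nhdsWithin_le_nhds
    exact ((eventually_mem_nhdsWithin).and (ht.eventually_lt_const hpos)).exists
  have hW := tendsto_horizLift p v
  have hz0 : Tendsto (fun z : ℝ × Heis × Heis => z.1) (𝓝 (0, p, v)) (𝓝 0) :=
    continuous_fst.tendsto (0, p, v)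
  have hlim : Tendsto (fun z : ℝ × Heis × Heis =>
      s * f' (horizLift z.2.1 z.2.2) - ε * (|s| * ‖horizLift z.2.1 z.2.2‖) - c * z.1)
      (𝓝 (0, p, v)) (𝓝 (s * f' (horizLift p v) - ε * (|s| * ‖horizLift p v‖) - c * 0)) :=
    ((((f'.continuous.tendsto _).comp hW).const_mul s).sub
      ((hW.norm.const_mul |s|).const_mul ε)).sub (hz0.const_mul c)
  filter_upwards [eventually_norm_sub_le hf v s 0 hε,
    hlim.eventually_const_lt (show (0 : ℝ) < _ by linarith)] with z h1 h2 hz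
  simp only [zero_mul, zero_smul, add_zero, sub_zero, abs_mul, abs_of_pos hz, Real.norm_eq_abs,
    smul_eq_mul] at h1
  nlinarith [neg_le_of_abs_le h1, mul_pos hz h2]

/-- Second-order case: a lower bound for the second derivative along a horizontal line
bounds the second symmetric difference from below. -/
lemma eventually_second_difference_ge {f : Heis → ℝ} {p : Heis} (hf : ContDiffAt ℝ 2 f p)
    (v : Heis) {c : ℝ} (hc : c < fderiv ℝ (fderiv ℝ f) p (horizLift p v) (horizLift p v)) :
    ∀ᶠ z : ℝ × Heis × Heis in 𝓝 (0, p, v), 0 < z.1 →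
      2 * f z.2.1 + c * z.1 ^ 2 ≤ f (z.2.1 + z.1 • horizLift z.2.1 z.2.2)
        + f (z.2.1 + (-z.1) • horizLift z.2.1 z.2.2) := by
  set B := fderiv ℝ (fderiv ℝ f) p with hB
  have hB' : HasStrictFDerivAt (fderiv ℝ f) B p :=
    (hf.fderiv_right (m := 1) (by norm_num)).hasStrictFDerivAt (by norm_num)
  have hdiff : ∀ᶠ q in 𝓝 p, DifferentiableAt ℝ f q :=
    (hf.eventually (by simp)).mono fun q hq => hq.differentiableAt (by norm_num)
  obtain ⟨ε, hε, hεlt⟩ : ∃ ε : ℝ, 0 < ε ∧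
      ε * ‖horizLift p v‖ ^ 2 < B (horizLift p v) (horizLift p v) - c := by
    have ht : Tendsto (fun ε : ℝ => ε * ‖horizLift p v‖ ^ 2) (𝓝[>] 0) (𝓝 0) := by
      have : Continuous fun ε : ℝ => ε * ‖horizLift p v‖ ^ 2 := by fun_prop
      simpa using (this.tendsto 0).mono_left nhdsWithin_le_nhds
    exact ((eventually_mem_nhdsWithin).and (ht.eventually_lt_const (sub_pos.2 hc))).exists
  have hW := tendsto_horizLift p v
  have hcont : Continuous fun w : Heis => B w w - ε * ‖w‖ ^ 2 := by fun_prop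
  have hlow := ((hcont.tendsto _).comp hW).eventually_const_lt (u := c) (by linarith)
  have hev : ∀ᶠ z : ℝ × Heis × Heis in 𝓝 (0, p, v),
      (0 < z.1 → 2 * c * z.1 ≤
        fderiv ℝ f (z.2.1 + z.1 • horizLift z.2.1 z.2.2) (horizLift z.2.1 z.2.2)
        - fderiv ℝ f (z.2.1 + (-z.1) • horizLift z.2.1 z.2.2) (horizLift z.2.1 z.2.2)) ∧
      DifferentiableAt ℝ f (z.2.1 + z.1 • horizLift z.2.1 z.2.2) ∧
      DifferentiableAt ℝ f (z.2.1 + (-z.1) • horizLift z.2.1 z.2.2) := by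
    filter_upwards [eventually_norm_sub_le hB' v 1 (-1) hε, hlow,
      (tendsto_add_smul_horizLift p v 1).eventually hdiff,
      (tendsto_add_smul_horizLift p v (-1)).eventually hdiff] with z h1 h2 h3 h4
    simp only [one_mul, neg_mul] at h1 h3 h4
    refine ⟨fun hz => ?_, h3, h4⟩
    set w := horizLift z.2.1 z.2.2
    have h5 := (ContinuousLinearMap.le_opNorm _ w).trans
      (mul_le_mul_of_nonneg_right h1 (norm_nonneg w))
    rw [abs_of_pos (by linarith : 0 < (1 - -1) * z.1)] at h5
    simp only [sub_apply, smul_apply, smul_eq_mul, Real.norm_eq_abs] at h5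
    have h6 : c < B w w - ε * ‖w‖ ^ 2 := h2
    nlinarith [neg_le_of_abs_le h5, mul_lt_mul_of_pos_left h6 hz]
  obtain ⟨ρ, hρ, hball⟩ := Metric.eventually_nhds_iff_ball.1 hev
  filter_upwards [Metric.ball_mem_nhds _ hρ] with z hz hz0
  obtain ⟨r, q, w'⟩ := z
  set w := horizLift q w'
  have hmem : ∀ t ∈ Set.Icc 0 r, (t, q, w') ∈ Metric.ball ((0 : ℝ), p, v) ρ := by
    intro t ht
    simp only [Metric.mem_ball, Prod.dist_eq, max_lt_iff, Real.dist_eq, sub_zero] at hz ⊢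
    exact ⟨(abs_le_abs_of_nonneg ht.1 ht.2).trans_lt hz.1, hz.2⟩
  have hder : ∀ t ∈ Set.Icc 0 r, HasDerivAt
      (fun t : ℝ => f (q + t • w) + f (q + (-t) • w) - c * t ^ 2)
      (fderiv ℝ f (q + t • w) w - fderiv ℝ f (q + (-t) • w) w - 2 * c * t) t := by
    intro t ht
    obtain ⟨-, h1, h2⟩ := hball _ (hmem t ht)
    have l1 : HasDerivAt (fun t : ℝ => q + t • w) w t := by
      simpa using ((hasDerivAt_id t).smul_const w).const_add q
    have l2 : HasDerivAt (fun t : ℝ => q + (-t) • w) (-w) t := by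
      simpa using ((hasDerivAt_id t).neg.smul_const w).const_add q
    have d1 := HasFDerivAt.comp_hasDerivAt t h1.hasFDerivAt l1
    have d2 := HasFDerivAt.comp_hasDerivAt t h2.hasFDerivAt l2
    refine ((d1.add d2).sub (((hasDerivAt_id t).pow 2).const_mul c)).congr_deriv ?_
    simp
    ring
  have hmono : MonotoneOn (fun t : ℝ => f (q + t • w) + f (q + (-t) • w) - c * t ^ 2)
      (Set.Icc 0 r) := by
    refine monotoneOn_of_deriv_nonneg (convex_Icc 0 r)
      (fun t ht => (hder t ht).continuousAt.continuousWithinAt)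
      (fun t ht => (hder t (interior_subset ht)).differentiableAt.differentiableWithinAt) ?_
    intro t ht
    rw [(hder t (interior_subset ht)).deriv]
    rw [interior_Icc] at ht
    have := (hball _ (hmem t ⟨ht.1.le, ht.2.le⟩)).1 ht.1
    linarith
  have h := hmono (Set.left_mem_Icc.2 hz0.le) (Set.right_mem_Icc.2 hz0.le) hz0.le
  simp only [zero_smul, neg_zero, add_zero] at h
  linarith

lemma isCompact_horiz_unitCircle :
    IsCompact {v : Heis | v ∈ horiz ∧ v.1 ^ 2 + v.2.1 ^ 2 = 1} := by
  refine Metric.isCompact_of_isClosed_isBounded ?_ ?_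
  · exact (isClosed_eq (by fun_prop) continuous_const).inter
      (isClosed_eq (by fun_prop) continuous_const)
  · refine (Metric.isBounded_closedBall (x := (0 : Heis)) (r := 1)).subset ?_
    rintro v ⟨hv, hv1⟩
    have hv0 : v.2.2 = 0 := hv
    simp only [mem_closedBall_zero_iff, Prod.norm_def, Real.norm_eq_abs, max_le_iff, hv0,
      abs_zero, zero_le_one, and_true]
    constructor <;> rw [← sq_le_one_iff_abs_le_one] <;>
      nlinarith [sq_nonneg v.1, sq_nonneg v.2.1]

theorem statement9 (Ω : Set Heis) (hΩ : IsOpen Ω) (lam : ℝ) (hlam : 0 < lam)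
    (f : Heis → ℝ) (hf : ContDiffOn ℝ 2 f Ω)
    (hL : ∀ p ∈ Ω, 2 * lam ≤ Lop f p) :
    ∀ K : Set Heis, IsCompact K → K ⊆ Ω → ∀ σ : ℝ, 0 < σ → σ < 1 →
      ∃ r₀ : ℝ, 0 < r₀ ∧ ∀ r : ℝ, 0 < r → r < r₀ → ∀ p ∈ K, ∀ v ∈ horiz,
        v.1 ^ 2 + v.2.1 ^ 2 = 1 →
        hMul p (r • v) ∈ Ω ∧ hMul p (-(r • v)) ∈ Ω ∧
        f p ≤ max (f (hMul p (r • v))) (f (hMul p (-(r • v)))) - σ * lam * r ^ 2 := by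
  intro K hK hKΩ σ _ hσ
  let P : ℝ → Heis × Heis → Prop := fun r k => 0 < r →
    k.1 + r • horizLift k.1 k.2 ∈ Ω ∧ k.1 + (-r) • horizLift k.1 k.2 ∈ Ω ∧
    f k.1 ≤ max (f (k.1 + r • horizLift k.1 k.2)) (f (k.1 + (-r) • horizLift k.1 k.2))
      - σ * lam * r ^ 2
  have hloc : ∀ k ∈ K ×ˢ {v : Heis | v ∈ horiz ∧ v.1 ^ 2 + v.2.1 ^ 2 = 1},
      ∀ᶠ z : ℝ × Heis × Heis in 𝓝 ((0 : ℝ), k), P z.1 z.2 := by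
    rintro ⟨p, v⟩ ⟨hp, hv, hv1⟩
    have hpΩ : Ω ∈ 𝓝 p := hΩ.mem_nhds (hKΩ hp)
    have hfp : ContDiffAt ℝ 2 f p := hf.contDiffAt hpΩ
    have hfs : HasStrictFDerivAt f (fderiv ℝ f p) p := hfp.hasStrictFDerivAt (by norm_num)
    have h1 := (tendsto_add_smul_horizLift p v 1).eventually_mem hpΩ
    have h2 := (tendsto_add_smul_horizLift p v (-1)).eventually_mem hpΩ
    simp only [one_mul, neg_mul] at h1 h2
    rcases lt_trichotomy (fderiv ℝ f p (horizLift p v)) 0 with h | h | h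
    · filter_upwards [h1, h2, eventually_add_sq_le_of_pos hfs (v := v) (-1) (σ * lam)
        (by linarith)] with z hz1 hz2 hz hpos
      have hz' := hz hpos
      rw [neg_one_mul] at hz'
      exact ⟨hz1, hz2, le_sub_iff_add_le.2 (hz'.trans (le_max_right _ _))⟩
    · have hB : 2 * lam ≤ fderiv ℝ (fderiv ℝ f) p (horizLift p v) (horizLift p v) := by
        rw [fderiv_fderiv_apply_horizLift
          ((hfp.fderiv_right (m := 1) (by norm_num)).differentiableAt (by norm_num))]
        rw [fderiv_apply_horizLift] at h
        exact (hL p (hKΩ hp)).trans (L0H_le (η := (v.1, v.2.1)) _ hv1 h)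
      filter_upwards [h1, h2, eventually_second_difference_ge hfp v
        (c := 2 * (σ * lam)) (by nlinarith)] with z hz1 hz2 hz hpos
      refine ⟨hz1, hz2, ?_⟩
      have hz' := hz hpos
      have hl := le_max_left (f (z.2.1 + z.1 • horizLift z.2.1 z.2.2))
        (f (z.2.1 + (-z.1) • horizLift z.2.1 z.2.2))
      have hr := le_max_right (f (z.2.1 + z.1 • horizLift z.2.1 z.2.2))
        (f (z.2.1 + (-z.1) • horizLift z.2.1 z.2.2))
      linarith
    · filter_upwards [h1, h2, eventually_add_sq_le_of_pos hfs (v := v) 1 (σ * lam)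
        (by linarith)] with z hz1 hz2 hz hpos
      have hz' := hz hpos
      rw [one_mul] at hz'
      exact ⟨hz1, hz2, le_sub_iff_add_le.2 (hz'.trans (le_max_left _ _))⟩
  have hev := (hK.prod isCompact_horiz_unitCircle).eventually_forall_of_forall_eventually (P := P) hloc
  obtain ⟨r₀, hr₀, hball⟩ := Metric.eventually_nhds_iff.1 hev
  refine ⟨r₀, hr₀, fun r hr hrr p hp v hv hv1 => ?_⟩
  rw [hMul_smul_eq p v hv, hMul_neg_smul_eq p v hv]
  exact hball (by simpa [abs_of_pos hr] using hrr) (p, v) ⟨hp, hv, hv1⟩ hr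
end
end

section
/- Let u₀ ∈ C(ℍ) be uniformly h-quasiconvex in ℍ with parameters r₀ > 0 and λ > 0, and let 0 < ε < r₀/√2. Let u_ε be the game value with terminal cost u₀ and step size ε. Then u_ε(p, t) ≥ u_ε(p, s) + 2λε²⌊(t−s)/ε²⌋ for all p ∈ ℍ and all t ≥ s ≥ 0. In particular, u_ε is nondecreasing in time. -/
open Filter Topology

noncomputable section

/-- The dynamic programming principle propagates an increment estimate from the initial
time layer to all times. -/
theorem increment_of_dpp {ε d c : ℝ} (hε : 0 < ε) (hd : 0 ≤ d) {uε : Heis → ℝ → ℝ}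
    (hdpp : ∀ p : Heis, ∀ t : ℝ, ε ^ 2 ≤ t →
      IsLeast {m : ℝ | ∃ v ∈ horiz, v.1 ^ 2 + v.2.1 ^ 2 = 1 ∧
        m = max (uε (hMul p ((Real.sqrt 2 * ε) • v)) (t - ε ^ 2))
                (uε (hMul p (-((Real.sqrt 2 * ε) • v))) (t - ε ^ 2))} (uε p t))
    (hbase : ∀ p : Heis, ∀ s t : ℝ, 0 ≤ s → s < ε ^ 2 → s + d ≤ t → uε p s + c ≤ uε p t)
    (p : Heis) (s t : ℝ) (hs : 0 ≤ s) (hst : s + d ≤ t) : uε p s + c ≤ uε p t := by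
  obtain ⟨n, hn⟩ : ∃ n : ℕ, s < (n + 1) * ε ^ 2 := by
    obtain ⟨n, hn⟩ := exists_nat_gt (s / ε ^ 2)
    refine ⟨n, ?_⟩
    rw [div_lt_iff₀ (by positivity)] at hn
    nlinarith [sq_nonneg ε]
  induction n generalizing p s t with
  | zero => exact hbase p s t hs (by simpa using hn) hst
  | succ n ih =>
    rcases lt_or_ge s (ε ^ 2) with h | h
    · exact hbase p s t hs h hst
    obtain ⟨v, hv, hv1, hmax⟩ := (hdpp p t (by linarith)).1
    have hle := (hdpp p s h).2 ⟨v, hv, hv1, rfl⟩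
    have hstep : ∀ q : Heis, uε q (s - ε ^ 2) + c ≤ uε q (t - ε ^ 2) := fun q =>
      ih q (s - ε ^ 2) (t - ε ^ 2) (by linarith) (by linarith)
        (by push_cast at hn; linarith)
    calc uε p s + c ≤ _ := by gcongr
      _ = _ := (max_add_add_right _ _ _).symm
      _ ≤ _ := max_le_max (hstep _) (hstep _)
      _ = uε p t := hmax.symm

theorem statement10 (u₀ : Heis → ℝ) (hc : Continuous u₀)
    (r₀ lam : ℝ) (hr₀ : 0 < r₀) (hlam : 0 < lam)
    (huqc : UniformlyHQuasiconvexOn u₀ Set.univ r₀ lam)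
    (ε : ℝ) (hε : 0 < ε) (hεr : ε < r₀ / Real.sqrt 2)
    (uε : Heis → ℝ → ℝ)
    (hinit : ∀ p : Heis, ∀ t : ℝ, 0 ≤ t → t < ε ^ 2 → uε p t = u₀ p)
    (hdpp : ∀ p : Heis, ∀ t : ℝ, ε ^ 2 ≤ t →
      IsLeast {m : ℝ | ∃ v ∈ horiz, v.1 ^ 2 + v.2.1 ^ 2 = 1 ∧
        m = max (uε (hMul p ((Real.sqrt 2 * ε) • v)) (t - ε ^ 2))
                (uε (hMul p (-((Real.sqrt 2 * ε) • v))) (t - ε ^ 2))} (uε p t)) :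
    (∀ p : Heis, ∀ s t : ℝ, 0 ≤ s → s ≤ t →
      uε p s + 2 * lam * ε ^ 2 * (⌊(t - s) / ε ^ 2⌋ : ℝ) ≤ uε p t) ∧
    (∀ p : Heis, ∀ s t : ℝ, 0 ≤ s → s ≤ t → uε p s ≤ uε p t) := by
  have hsqrt : Real.sqrt 2 ^ 2 = 2 := Real.sq_sqrt (by norm_num)
  have hr_lt : Real.sqrt 2 * ε < r₀ := by
    rw [lt_div_iff₀ (by positivity)] at hεr
    linarith
  have hε2 : 0 < ε ^ 2 := by positivity
  have hgain : 0 < 2 * lam * ε ^ 2 := by positivity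
  have huqc' : ∀ p v : Heis, v ∈ horiz → v.1 ^ 2 + v.2.1 ^ 2 = 1 →
      u₀ p + 2 * lam * ε ^ 2 ≤ max (u₀ (hMul p ((Real.sqrt 2 * ε) • v)))
        (u₀ (hMul p (-((Real.sqrt 2 * ε) • v)))) := by
    intro p v hv hv1
    have h := huqc (Real.sqrt 2 * ε) (by positivity) hr_lt p trivial v hv hv1 trivial trivial
    rw [mul_pow, hsqrt] at h
    linarith
  have hlayer : ∀ n : ℕ, ∀ p t, 0 ≤ t → t < (n + 1) * ε ^ 2 → u₀ p ≤ uε p t ∧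
      (ε ^ 2 ≤ t → u₀ p + 2 * lam * ε ^ 2 ≤ uε p t) := by
    intro n
    induction n with
    | zero =>
      intro p t ht htn
      have htn' : t < ε ^ 2 := by simpa using htn
      exact ⟨(hinit p t ht htn').ge, fun h => absurd h (not_le.2 htn')⟩
    | succ n ih =>
      intro p t ht htn
      rcases lt_or_ge t (ε ^ 2) with h | h
      · exact ⟨(hinit p t ht h).ge, fun h' => absurd h' (not_le.2 h)⟩
      obtain ⟨v, hv, hv1, hmax⟩ := (hdpp p t h).1
      have hstep : ∀ q : Heis, u₀ q ≤ uε q (t - ε ^ 2) := fun q =>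
        (ih q (t - ε ^ 2) (by linarith) (by push_cast at htn; linarith)).1
      have hmain : u₀ p + 2 * lam * ε ^ 2 ≤ uε p t :=
        (huqc' p v hv hv1).trans ((max_le_max (hstep _) (hstep _)).trans hmax.ge)
      exact ⟨by linarith, fun _ => hmain⟩
  have hinitial : ∀ p t, 0 ≤ t → u₀ p ≤ uε p t ∧
      (ε ^ 2 ≤ t → u₀ p + 2 * lam * ε ^ 2 ≤ uε p t) := by
    intro p t ht
    obtain ⟨n, hn⟩ := exists_nat_gt (t / ε ^ 2)
    rw [div_lt_iff₀ hε2] at hn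
    exact hlayer n p t ht (by linarith)
  have hmono : ∀ p : Heis, ∀ s t : ℝ, 0 ≤ s → s ≤ t → uε p s ≤ uε p t := by
    intro p s t hs hst
    have h := increment_of_dpp (d := 0) (c := 0) hε le_rfl hdpp
      (fun p s t hs hsε hst => by
        rw [hinit p s hs hsε, add_zero]
        exact (hinitial p t (by linarith)).1) p s t hs (by linarith)
    linarith
  have hstep := increment_of_dpp (d := ε ^ 2) (c := 2 * lam * ε ^ 2) hε hε2.le hdpp
    (fun p s t hs hsε hst => by
      rw [hinit p s hs hsε]
      exact (hinitial p t (by linarith)).2 (by linarith))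
  have hiter : ∀ k : ℕ, ∀ p : Heis, ∀ s t : ℝ, 0 ≤ s → s + k * ε ^ 2 ≤ t →
      uε p s + 2 * lam * ε ^ 2 * k ≤ uε p t := by
    intro k
    induction k with
    | zero =>
      intro p s t hs hst
      simpa using hmono p s t hs (by simpa using hst)
    | succ k ih =>
      intro p s t hs hst
      push_cast at hst ⊢
      have h₁ := ih p s (s + k * ε ^ 2) hs le_rfl
      have h₂ := hstep p (s + k * ε ^ 2) t (by positivity) (by linarith)
      linarith
  refine ⟨fun p s t hs hst => ?_, hmono⟩
  have hfloor : 0 ≤ ⌊(t - s) / ε ^ 2⌋ :=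
    Int.floor_nonneg.2 (div_nonneg (sub_nonneg.2 hst) hε2.le)
  obtain ⟨k, hk⟩ := Int.eq_ofNat_of_zero_le hfloor
  have hk_le := Int.floor_le ((t - s) / ε ^ 2)
  rw [hk, le_div_iff₀ hε2] at hk_le
  rw [hk]
  push_cast at hk_le ⊢
  exact hiter k p s t hs (by linarith)
end
end
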